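/- Let ρ : CS_c.c(ℝⁿ) → ℂ (n ≥ 2) be a singular linear form with Stokes' property. Then Ker(res) ⊆ Ker(ρ): every classical symbol σ with constant coefficients satisfying res(σ) = 0 also satisfies ρ(σ) = 0. -/

import Mathlib

open MeasureTheory Metric Filter Complex
open scoped Topology RealInnerProductSpace Classical

noncomputable section

/-- ℝⁿ with the euclidean norm. -/
abbrev Euc (n : ℕ) := EuclideanSpace ℝ (Fin n)

/-- Partial derivative in the `i`-th coordinate direction. -/
def pd {n : ℕ} (i : Fin n) (f : Euc n → ℂ) : Euc n → ℂ :=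
  fun ξ => fderiv ℝ f ξ (EuclideanSpace.single i 1)

/-- Iterated partial derivatives along a list of coordinate directions
(a multi-index `β` corresponds to the lists containing `i` exactly `β i` times). -/
def pdIter {n : ℕ} : List (Fin n) → (Euc n → ℂ) → (Euc n → ℂ)
  | [], f => f
  | i :: L, f => pd i (pdIter L f)

/-- A smooth cut-off function vanishing near `0` and equal to `1` outside the unit ball. -/
structure IsCutoff {n : ℕ} (χ : Euc n → ℝ) : Prop where
  smooth : ContDiff ℝ (⊤ : ℕ∞) χ
  zero_near : ∃ ε > (0:ℝ), ∀ ξ : Euc n, ‖ξ‖ < ε → χ ξ = 0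
  one_far : ∀ ξ : Euc n, 1 ≤ ‖ξ‖ → χ ξ = 1

/-- `σ` is a classical symbol of order `a` with constant coefficients on `ℝⁿ`, with
homogeneous components `σc j` of degree `a - j`. -/
structure IsCS {n : ℕ} (χ : Euc n → ℝ) (a : ℂ) (σ : Euc n → ℂ)
    (σc : ℕ → Euc n → ℂ) : Prop where
  smooth : ContDiff ℝ (⊤ : ℕ∞) σ
  comp_smooth : ∀ j, ContDiffOn ℝ (⊤ : ℕ∞) (σc j) {(0 : Euc n)}ᶜ
  comp_homog : ∀ (j : ℕ) (t : ℝ), 0 < t → ∀ ξ : Euc n, ξ ≠ 0 →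
    σc j (t • ξ) = (t : ℂ) ^ (a - j) * σc j ξ
  estimate : ∀ (N : ℕ) (L : List (Fin n)), ∃ C > (0:ℝ), ∀ ξ : Euc n,
    ‖pdIter L (fun η => σ η - ∑ j ∈ Finset.range N, (χ η : ℂ) * σc j η) ξ‖ ≤
      C * (1 + ‖ξ‖) ^ (a.re - N - L.length : ℝ)

/-- A smoothing symbol with constant coefficients on `ℝⁿ`. -/
def IsSmoothing {n : ℕ} (σ : Euc n → ℂ) : Prop :=
  ContDiff ℝ (⊤ : ℕ∞) σ ∧
    ∀ (L : List (Fin n)) (M : ℝ), 0 < M → ∃ C > (0:ℝ), ∀ ξ : Euc n,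
      ‖pdIter L σ ξ‖ ≤ C * (1 + ‖ξ‖) ^ (-M)

/-- The surface measure on the unit sphere `S^{n-1} ⊂ ℝⁿ`. -/
def sphMeas (n : ℕ) : Measure (sphere (0 : Euc n) 1) :=
  (volume : Measure (Euc n)).toSphere

/-- The integral of a homogeneous component over the unit sphere. -/
def sphInt {n : ℕ} (f : Euc n → ℂ) : ℂ :=
  ∫ ω : sphere (0 : Euc n) 1, f ↑ω ∂(sphMeas n)

/-- The noncommutative residue of a classical symbol of order `a` with homogeneous
components `σc j` of degree `a - j`. -/
def resCC {n : ℕ} (a : ℂ) (σc : ℕ → Euc n → ℂ) : ℂ :=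
  if h : ∃ j : ℕ, a - j = -(n : ℂ) then
    (((2 * Real.pi) ^ (-(n : ℝ) / 2) : ℝ) : ℂ) * sphInt (σc h.choose)
  else 0

/-- The cut-off regularised integral of a classical symbol of order `a` with homogeneous
components `σc`, computed with an integer `N` such that `Re a - N < -n`. -/
def cutoffInt {n : ℕ} (χ : Euc n → ℝ) (a : ℂ) (σ : Euc n → ℂ)
    (σc : ℕ → Euc n → ℂ) (N : ℕ) : ℂ :=
  (∫ ξ : Euc n, (σ ξ - ∑ j ∈ Finset.range N, (χ ξ : ℂ) * σc j ξ))
  + ∑ j ∈ Finset.range N, ∫ ξ in Metric.ball (0 : Euc n) 1, (χ ξ : ℂ) * σc j ξ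
  - ∑ j ∈ Finset.range N,
      if a - j + n ≠ 0 then (a - j + n)⁻¹ * sphInt (σc j) else 0


/-- The linear span of all classical symbols with constant coefficients on `ℝⁿ`. -/
def CSspan (n : ℕ) (χ : Euc n → ℝ) : Submodule ℂ (Euc n → ℂ) :=
  Submodule.span ℂ {σ | ∃ a σc, IsCS χ a σ σc}

section Auxiliary

variable {n : ℕ}

/-! ### Calculus of the partial derivatives -/

lemma pd_congr {V : Set (Euc n)} (hV : IsOpen V) {f g : Euc n → ℂ} (h : Set.EqOn f g V)
    (i : Fin n) : Set.EqOn (pd i f) (pd i g) V := by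
  intro ξ hξ
  have : f =ᶠ[𝓝 ξ] g := Filter.eventuallyEq_of_mem (hV.mem_nhds hξ) h
  simp only [pd, this.fderiv_eq]

lemma pdIter_congr {V : Set (Euc n)} (hV : IsOpen V) {f g : Euc n → ℂ} (h : Set.EqOn f g V)
    (L : List (Fin n)) : Set.EqOn (pdIter L f) (pdIter L g) V := by
  induction L with
  | nil => exact h
  | cons i L ih => exact pd_congr hV ih i

lemma pdIter_concat (L : List (Fin n)) (i : Fin n) (f : Euc n → ℂ) :
    pdIter (L ++ [i]) f = pdIter L (pd i f) := by
  induction L with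
  | nil => rfl
  | cons j L ih => simp only [List.cons_append, pdIter, ih]

lemma ContDiffOn.differentiableAt_of_isOpen {V : Set (Euc n)} (hV : IsOpen V) {f : Euc n → ℂ}
    (hf : ContDiffOn ℝ (⊤ : ℕ∞) f V) {ξ : Euc n} (hξ : ξ ∈ V) : DifferentiableAt ℝ f ξ :=
  (hf.contDiffAt (hV.mem_nhds hξ)).differentiableAt (by simp)

lemma ContDiffOn.pd {V : Set (Euc n)} (hV : IsOpen V) {f : Euc n → ℂ}
    (hf : ContDiffOn ℝ (⊤ : ℕ∞) f V) (i : Fin n) : ContDiffOn ℝ (⊤ : ℕ∞) (pd i f) V :=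
  (hf.fderiv_of_isOpen (m := (⊤ : ℕ∞)) hV (by simp)).clm_apply contDiffOn_const

lemma ContDiffOn.pdIter {V : Set (Euc n)} (hV : IsOpen V) {f : Euc n → ℂ}
    (hf : ContDiffOn ℝ (⊤ : ℕ∞) f V) (L : List (Fin n)) :
    ContDiffOn ℝ (⊤ : ℕ∞) (pdIter L f) V := by
  induction L with
  | nil => exact hf
  | cons i L ih => exact ih.pd hV i

lemma ContDiff.pd {f : Euc n → ℂ} (hf : ContDiff ℝ (⊤ : ℕ∞) f) (i : Fin n) :
    ContDiff ℝ (⊤ : ℕ∞) (pd i f) :=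
  contDiffOn_univ.1 (hf.contDiffOn.pd isOpen_univ i)

lemma ContDiff.pdIter {f : Euc n → ℂ} (hf : ContDiff ℝ (⊤ : ℕ∞) f) (L : List (Fin n)) :
    ContDiff ℝ (⊤ : ℕ∞) (pdIter L f) :=
  contDiffOn_univ.1 (hf.contDiffOn.pdIter isOpen_univ L)

lemma pd_add_apply {f g : Euc n → ℂ} {ξ : Euc n} (hf : DifferentiableAt ℝ f ξ)
    (hg : DifferentiableAt ℝ g ξ) (i : Fin n) :
    pd i (fun η => f η + g η) ξ = pd i f ξ + pd i g ξ := by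
  simp [pd, fderiv_fun_add hf hg]

lemma pd_sum_apply {ι : Type*} (s : Finset ι) {f : ι → Euc n → ℂ} {ξ : Euc n}
    (hf : ∀ j ∈ s, DifferentiableAt ℝ (f j) ξ) (i : Fin n) :
    pd i (fun η => ∑ j ∈ s, f j η) ξ = ∑ j ∈ s, pd i (f j) ξ := by
  simp [pd, fderiv_fun_sum hf]

lemma pd_sub_apply {f g : Euc n → ℂ} {ξ : Euc n} (hf : DifferentiableAt ℝ f ξ)
    (hg : DifferentiableAt ℝ g ξ) (i : Fin n) :
    pd i (fun η => f η - g η) ξ = pd i f ξ - pd i g ξ := by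
  simp [pd, fderiv_fun_sub hf hg]

lemma pd_const_mul_apply {f : Euc n → ℂ} {ξ : Euc n} (hf : DifferentiableAt ℝ f ξ) (c : ℂ)
    (i : Fin n) : pd i (fun η => c * f η) ξ = c * pd i f ξ := by
  simp [pd, fderiv_const_mul hf]

lemma pd_mul_apply {f g : Euc n → ℂ} {ξ : Euc n} (hf : DifferentiableAt ℝ f ξ)
    (hg : DifferentiableAt ℝ g ξ) (i : Fin n) :
    pd i (fun η => f η * g η) ξ = pd i f ξ * g ξ + f ξ * pd i g ξ := by
  simp only [pd, fderiv_fun_mul hf hg, FunLike.coe_add, Pi.add_apply, FunLike.coe_smul,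
    Pi.smul_apply, smul_eq_mul]
  ring

lemma pdIter_add {V : Set (Euc n)} (hV : IsOpen V) {f g : Euc n → ℂ}
    (hf : ContDiffOn ℝ (⊤ : ℕ∞) f V) (hg : ContDiffOn ℝ (⊤ : ℕ∞) g V) (L : List (Fin n)) :
    Set.EqOn (pdIter L (fun η => f η + g η)) (fun η => pdIter L f η + pdIter L g η) V := by
  induction L with
  | nil => exact fun _ _ => rfl
  | cons i L ih =>
    intro ξ hξ
    simp only [pdIter]
    rw [pd_congr hV ih i hξ, pd_add_apply
      ((hf.pdIter hV L).differentiableAt_of_isOpen hV hξ)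
      ((hg.pdIter hV L).differentiableAt_of_isOpen hV hξ)]

lemma pdIter_const_mul {V : Set (Euc n)} (hV : IsOpen V) {f : Euc n → ℂ}
    (hf : ContDiffOn ℝ (⊤ : ℕ∞) f V) (c : ℂ) (L : List (Fin n)) :
    Set.EqOn (pdIter L (fun η => c * f η)) (fun η => c * pdIter L f η) V := by
  induction L with
  | nil => exact fun _ _ => rfl
  | cons i L ih =>
    intro ξ hξ
    simp only [pdIter]
    rw [pd_congr hV ih i hξ, pd_const_mul_apply
      ((hf.pdIter hV L).differentiableAt_of_isOpen hV hξ)]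

lemma sum_coord_smul_single (v : Euc n) :
    ∑ i, v i • (EuclideanSpace.single i (1 : ℝ) : Euc n) = v := by
  ext j
  simp [Finset.sum_apply, Pi.single_apply]

lemma fderiv_apply_eq_sum (f : Euc n → ℂ) (ξ v : Euc n) :
    fderiv ℝ f ξ v = ∑ i, (v i : ℂ) * pd i f ξ := by
  conv_lhs => rw [← sum_coord_smul_single v]
  simp [pd]

lemma fderiv_eq_sum (f : Euc n → ℂ) (ξ : Euc n) :
    fderiv ℝ f ξ = ∑ i, (EuclideanSpace.proj i : Euc n →L[ℝ] ℝ).smulRight (pd i f ξ) := by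
  ext v
  rw [fderiv_apply_eq_sum]
  simp

/-- The `i`-th coordinate as a complex valued function. -/
def coordFn (i : Fin n) : Euc n → ℂ := fun ξ => ((ξ i : ℝ) : ℂ)

lemma contDiff_coordFn (i : Fin n) : ContDiff ℝ (⊤ : ℕ∞) (coordFn i) :=
  Complex.ofRealCLM.contDiff.comp (EuclideanSpace.proj (𝕜 := ℝ) i).contDiff

lemma pd_coordFn (i : Fin n) (ξ : Euc n) : pd i (coordFn i) ξ = 1 := by
  have : coordFn i = fun ξ => (Complex.ofRealCLM.comp
    (EuclideanSpace.proj (𝕜 := ℝ) i : Euc n →L[ℝ] ℝ)) ξ := rfl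
  rw [pd, this, ContinuousLinearMap.fderiv]
  simp

lemma sum_pd_coord_mul {f : Euc n → ℂ} {ξ : Euc n} (hf : DifferentiableAt ℝ f ξ) :
    ∑ i, pd i (fun η => coordFn i η * f η) ξ = n * f ξ + fderiv ℝ f ξ ξ := by
  rw [fderiv_apply_eq_sum]
  have : ∀ i, pd i (fun η => coordFn i η * f η) ξ = f ξ + ξ i * pd i f ξ := fun i => by
    rw [pd_mul_apply ((contDiff_coordFn i).differentiable (by simp)).differentiableAt hf,
      pd_coordFn]
    simp [coordFn]
  simp [this, Finset.sum_add_distrib]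

/-! ### Symbol estimates outside a ball -/

/-- The exterior of the closed ball of radius `r`. -/
def outerSet (n : ℕ) (r : ℝ) : Set (Euc n) := {ξ | r < ‖ξ‖}

lemma isOpen_outerSet (r : ℝ) : IsOpen (outerSet n r) := isOpen_lt continuous_const continuous_norm

lemma norm_pos_of_mem_outerSet {r : ℝ} (hr : 1 ≤ r) {ξ : Euc n} (h : ξ ∈ outerSet n r) : 0 < ‖ξ‖ :=
  lt_trans (by linarith) (show r < ‖ξ‖ from h)

lemma outerSet_subset_compl {r : ℝ} (hr : 1 ≤ r) : outerSet n r ⊆ {(0 : Euc n)}ᶜ := fun _ h =>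
  norm_pos_iff.1 (norm_pos_of_mem_outerSet hr h)

lemma outerSet_anti {r s : ℝ} (h : r ≤ s) : outerSet n s ⊆ outerSet n r :=
  fun _ hξ => lt_of_le_of_lt h hξ

/-- Smooth functions on the exterior of the ball of radius `r` satisfying symbol estimates of
real order `m` there. -/
def SymOn (r m : ℝ) (f : Euc n → ℂ) : Prop :=
  ContDiffOn ℝ (⊤ : ℕ∞) f (outerSet n r) ∧ ∀ L : List (Fin n), ∃ C > (0 : ℝ), ∀ ξ ∈ outerSet n r,
    ‖pdIter L f ξ‖ ≤ C * ‖ξ‖ ^ (m - L.length)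

lemma SymOn.congr {r m : ℝ} {f g : Euc n → ℂ} (hf : SymOn r m f)
    (h : Set.EqOn g f (outerSet n r)) : SymOn r m g := by
  refine ⟨hf.1.congr h, fun L => ?_⟩
  obtain ⟨C, hC, hL⟩ := hf.2 L
  refine ⟨C, hC, fun ξ hξ => ?_⟩
  rw [pdIter_congr (isOpen_outerSet r) h L hξ]
  exact hL ξ hξ

lemma SymOn.mono {r s m : ℝ} {f : Euc n → ℂ} (hf : SymOn r m f) (h : r ≤ s) : SymOn s m f := by
  refine ⟨hf.1.mono (outerSet_anti h), fun L => ?_⟩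
  obtain ⟨C, hC, hL⟩ := hf.2 L
  exact ⟨C, hC, fun ξ hξ => hL ξ (outerSet_anti h hξ)⟩

lemma SymOn.mono_order {r m m' : ℝ} (hr : 1 ≤ r) {f : Euc n → ℂ} (hf : SymOn r m f)
    (h : m ≤ m') : SymOn r m' f := by
  refine ⟨hf.1, fun L => ?_⟩
  obtain ⟨C, hC, hL⟩ := hf.2 L
  refine ⟨C, hC, fun ξ hξ => (hL ξ hξ).trans ?_⟩
  have : 1 ≤ ‖ξ‖ := hr.trans (le_of_lt hξ)
  gcongr

lemma SymOn.add {r m : ℝ} {f g : Euc n → ℂ} (hf : SymOn r m f) (hg : SymOn r m g) :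
    SymOn r m (fun ξ => f ξ + g ξ) := by
  refine ⟨hf.1.add hg.1, fun L => ?_⟩
  obtain ⟨C, hC, hL⟩ := hf.2 L
  obtain ⟨D, hD, hL'⟩ := hg.2 L
  refine ⟨C + D, by positivity, fun ξ hξ => ?_⟩
  rw [pdIter_add (isOpen_outerSet r) hf.1 hg.1 L hξ, add_mul]
  exact (norm_add_le _ _).trans (add_le_add (hL ξ hξ) (hL' ξ hξ))

lemma SymOn.const_mul {r m : ℝ} {f : Euc n → ℂ} (hf : SymOn r m f) (c : ℂ) :
    SymOn r m (fun ξ => c * f ξ) := by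
  refine ⟨contDiffOn_const.mul hf.1, fun L => ?_⟩
  obtain ⟨C, hC, hL⟩ := hf.2 L
  refine ⟨(‖c‖ + 1) * C, by positivity, fun ξ hξ => ?_⟩
  rw [pdIter_const_mul (isOpen_outerSet r) hf.1 c L hξ, norm_mul, mul_assoc]
  exact mul_le_mul (by linarith) (hL ξ hξ) (norm_nonneg _) (by positivity)

lemma SymOn.pd {r m : ℝ} {f : Euc n → ℂ} (hf : SymOn r m f) (i : Fin n) :
    SymOn r (m - 1) (pd i f) := by
  refine ⟨hf.1.pd (isOpen_outerSet r) i, fun L => ?_⟩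
  obtain ⟨C, hC, hL⟩ := hf.2 (L ++ [i])
  refine ⟨C, hC, fun ξ hξ => ?_⟩
  have := hL ξ hξ
  rw [pdIter_concat] at this
  refine this.trans (le_of_eq ?_)
  simp only [List.length_append, List.length_singleton]
  push_cast
  ring_nf

lemma SymOn.mul {r : ℝ} (hr : 1 ≤ r) {m₁ m₂ : ℝ} {f g : Euc n → ℂ} (hf : SymOn r m₁ f)
    (hg : SymOn r m₂ g) : SymOn r (m₁ + m₂) (fun ξ => f ξ * g ξ) := by
  refine ⟨hf.1.mul hg.1, fun L => ?_⟩
  induction L using List.reverseRecOn generalizing f g m₁ m₂ with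
  | nil =>
    obtain ⟨C, hC, hL⟩ := hf.2 []
    obtain ⟨D, hD, hL'⟩ := hg.2 []
    refine ⟨C * D, by positivity, fun ξ hξ => ?_⟩
    have h1 := hL ξ hξ
    have h2 := hL' ξ hξ
    simp only [pdIter, List.length_nil, Nat.cast_zero, sub_zero, norm_mul] at h1 h2 ⊢
    rw [Real.rpow_add (norm_pos_of_mem_outerSet hr hξ)]
    calc _ ≤ (C * ‖ξ‖ ^ m₁) * (D * ‖ξ‖ ^ m₂) := by gcongr
      _ = _ := by ring
  | append_singleton L i ih =>
    obtain ⟨C, hC, h1⟩ := ih (hf.pd i) hg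
    obtain ⟨D, hD, h2⟩ := ih hf (hg.pd i)
    refine ⟨C + D, by positivity, fun ξ hξ => ?_⟩
    have hV := isOpen_outerSet (n := n) r
    have e : Set.EqOn (_root_.pd i (fun ξ => f ξ * g ξ))
        (fun ξ => _root_.pd i f ξ * g ξ + f ξ * _root_.pd i g ξ) (outerSet n r) := fun η hη =>
      pd_mul_apply (hf.1.differentiableAt_of_isOpen hV hη)
        (hg.1.differentiableAt_of_isOpen hV hη) i
    rw [pdIter_concat, pdIter_congr hV e L hξ,
      pdIter_add hV ((hf.pd i).1.mul hg.1) (hf.1.mul (hg.pd i).1) L hξ, add_mul]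
    refine (norm_add_le _ _).trans (add_le_add ((h1 ξ hξ).trans (le_of_eq ?_))
      ((h2 ξ hξ).trans (le_of_eq ?_))) <;>
    · simp only [List.length_append, List.length_singleton]
      push_cast
      ring_nf

lemma SymOn.zero (r m : ℝ) : SymOn r m (fun _ : Euc n => (0 : ℂ)) := by
  refine ⟨contDiffOn_const, fun L => ⟨1, one_pos, fun ξ _ => ?_⟩⟩
  have : pdIter L (fun _ : Euc n => (0 : ℂ)) = fun _ => 0 := by
    induction L with
    | nil => rfl
    | cons i L ih => simp only [pdIter, ih]; ext; simp [_root_.pd]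
  rw [this, norm_zero]
  positivity

lemma one_add_rpow_le {x : ℝ} (hx : 1 ≤ x) (p : ℝ) : (1 + x) ^ p ≤ 2 ^ |p| * x ^ p := by
  have hx0 : 0 < x := by linarith
  rcases le_total 0 p with hp | hp
  · rw [abs_of_nonneg hp, ← Real.mul_rpow (by norm_num) hx0.le]
    exact Real.rpow_le_rpow (by linarith) (by linarith) hp
  · calc (1 + x) ^ p ≤ x ^ p := Real.rpow_le_rpow_of_nonpos hx0 (by linarith) hp
      _ ≤ 2 ^ |p| * x ^ p := le_mul_of_one_le_left (by positivity)
        (Real.one_le_rpow (by norm_num) (abs_nonneg p))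

lemma rpow_le_one_add {x : ℝ} (hx : 1 ≤ x) (p : ℝ) : x ^ p ≤ 2 ^ |p| * (1 + x) ^ p := by
  have hx0 : 0 < x := by linarith
  have h := one_add_rpow_le hx (-p)
  rw [abs_neg, Real.rpow_neg (by linarith), Real.rpow_neg hx0.le] at h
  have h1 : 0 < x ^ p := by positivity
  have h2 : 0 < (1 + x) ^ p := by positivity
  calc x ^ p = ((1 + x) ^ p)⁻¹ * ((1 + x) ^ p * x ^ p) := by field_simp
    _ ≤ (2 ^ |p| * (x ^ p)⁻¹) * ((1 + x) ^ p * x ^ p) := by gcongr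
    _ = _ := by field_simp

/-- For a function smooth on the whole space the symbol estimates need only be checked outside
a ball. -/
lemma SymOn.exists_bound {r m : ℝ} (hr : 1 ≤ r) {f : Euc n → ℂ} (hf : SymOn r m f)
    (hs : ContDiff ℝ (⊤ : ℕ∞) f) (L : List (Fin n)) :
    ∃ C > (0 : ℝ), ∀ ξ, ‖pdIter L f ξ‖ ≤ C * (1 + ‖ξ‖) ^ (m - L.length) := by
  obtain ⟨C, hC, hL⟩ := hf.2 L
  set p : ℝ := m - L.length with hp
  have hpos : ∀ ξ : Euc n, 0 < (1 + ‖ξ‖) ^ p := fun ξ => by positivity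
  have hcont : ContinuousOn (fun ξ => ‖pdIter L f ξ‖ / (1 + ‖ξ‖) ^ p) (closedBall 0 r) := by
    refine Continuous.continuousOn ((hs.pdIter L).continuous.norm.div ?_ fun ξ => (hpos ξ).ne')
    exact (continuous_const.add continuous_norm).rpow_const fun ξ =>
      Or.inl (add_pos_of_pos_of_nonneg one_pos (norm_nonneg ξ)).ne'
  obtain ⟨D, hD⟩ := (isCompact_closedBall (0 : Euc n) r).bddAbove_image hcont
  refine ⟨max (2 ^ |p| * C) D, lt_max_of_lt_left (by positivity), fun ξ => ?_⟩
  by_cases h : r < ‖ξ‖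
  · calc _ ≤ C * ‖ξ‖ ^ p := hL ξ h
      _ ≤ C * (2 ^ |p| * (1 + ‖ξ‖) ^ p) := by
        gcongr; exact rpow_le_one_add (hr.trans h.le) p
      _ = (2 ^ |p| * C) * (1 + ‖ξ‖) ^ p := by ring
      _ ≤ _ := by gcongr; exact le_max_left _ _
  · have := hD (Set.mem_image_of_mem _ (mem_closedBall_zero_iff.2 (not_lt.1 h)))
    rw [div_le_iff₀ (hpos ξ)] at this
    exact this.trans (by gcongr; exact le_max_right _ _)

/-! ### Homogeneous functions -/

/-- Smooth functions on the punctured space which are positively homogeneous of degree `b`. -/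
structure Homog (b : ℂ) (f : Euc n → ℂ) : Prop where
  smooth : ContDiffOn ℝ (⊤ : ℕ∞) f {(0 : Euc n)}ᶜ
  homog : ∀ t : ℝ, 0 < t → ∀ ξ : Euc n, ξ ≠ 0 → f (t • ξ) = (t : ℂ) ^ b * f ξ

lemma Homog.differentiableAt {b : ℂ} {f : Euc n → ℂ} (hf : Homog b f) {ξ : Euc n}
    (hξ : ξ ≠ 0) : DifferentiableAt ℝ f ξ :=
  hf.smooth.differentiableAt_of_isOpen isOpen_compl_singleton hξ

lemma Homog.const_mul {b : ℂ} {f : Euc n → ℂ} (hf : Homog b f) (c : ℂ) :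
    Homog b (fun ξ => c * f ξ) :=
  ⟨contDiffOn_const.mul hf.smooth, fun t ht ξ hξ => by rw [hf.homog t ht ξ hξ]; ring⟩

lemma Homog.zero (b : ℂ) : Homog b (fun _ : Euc n => (0 : ℂ)) :=
  ⟨contDiffOn_const, by simp⟩

lemma Homog.mul {b c : ℂ} {f g : Euc n → ℂ} (hf : Homog b f) (hg : Homog c g) :
    Homog (b + c) (fun ξ => f ξ * g ξ) :=
  ⟨hf.smooth.mul hg.smooth, fun t ht ξ hξ => by
    rw [hf.homog t ht ξ hξ, hg.homog t ht ξ hξ, Complex.cpow_add _ _ (by exact_mod_cast ht.ne')]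
    ring⟩

lemma homog_coordFn (i : Fin n) : Homog 1 (coordFn i) :=
  ⟨(contDiff_coordFn i).contDiffOn, fun t _ ξ _ => by simp [coordFn]⟩

lemma Homog.pd {b : ℂ} {f : Euc n → ℂ} (hf : Homog b f) (i : Fin n) : Homog (b - 1) (pd i f) := by
  refine ⟨hf.smooth.pd isOpen_compl_singleton i, fun t ht ξ hξ => ?_⟩
  have h0 : t • ξ ≠ 0 := smul_ne_zero ht.ne' hξ
  have ht' : (t : ℂ) ≠ 0 := by exact_mod_cast ht.ne'
  have e : (fun η => f (t • η)) =ᶠ[𝓝 ξ] fun η => (t : ℂ) ^ b * f η :=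
    Filter.eventuallyEq_of_mem (isOpen_compl_singleton.mem_nhds hξ) fun η hη => hf.homog t ht η hη
  have h1 := congrArg (fun A : Euc n →L[ℝ] ℂ => A (EuclideanSpace.single i 1)) e.fderiv_eq
  rw [fderiv_const_mul (hf.differentiableAt hξ), fderiv_comp_smul] at h1
  simp only [FunLike.coe_smul, Pi.smul_apply, smul_eq_mul, real_smul] at h1
  rw [Complex.cpow_sub _ _ ht', Complex.cpow_one]
  simp only [_root_.pd]
  field_simp
  linear_combination h1

lemma Homog.fderiv_self {b : ℂ} {f : Euc n → ℂ} (hf : Homog b f) {ξ : Euc n} (hξ : ξ ≠ 0) :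
    fderiv ℝ f ξ ξ = b * f ξ := by
  have h1 : HasDerivAt (fun t : ℝ => f (t • ξ)) (fderiv ℝ f ξ ξ) 1 := by
    have hd : HasFDerivAt f (fderiv ℝ f ξ) ((1 : ℝ) • ξ) := by
      rw [one_smul]; exact (hf.differentiableAt hξ).hasFDerivAt
    have := hd.comp_hasDerivAt (1 : ℝ) ((hasDerivAt_id (1 : ℝ)).smul_const ξ)
    rw [one_smul] at this
    exact this
  have h2 : HasDerivAt (fun t : ℝ => (t : ℂ) ^ b * f ξ) (b * f ξ) 1 := by
    have := ((hasDerivAt_id ((1 : ℝ) : ℂ)).cpow_const (c := b)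
      (by simp)).comp_ofReal.mul_const (f ξ)
    simpa using this
  refine h1.unique (h2.congr_of_eventuallyEq ?_)
  filter_upwards [lt_mem_nhds (zero_lt_one' ℝ)] with t ht using hf.homog t ht ξ hξ

lemma Homog.pdIter {b : ℂ} {f : Euc n → ℂ} (hf : Homog b f) (L : List (Fin n)) :
    Homog (b - L.length) (pdIter L f) := by
  induction L with
  | nil => simpa [_root_.pdIter] using hf
  | cons i L ih =>
    have := ih.pd i
    rw [sub_sub] at this
    simpa [_root_.pdIter] using this

lemma Homog.exists_bound {b : ℂ} {f : Euc n → ℂ} (hf : Homog b f) :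
    ∃ C > (0 : ℝ), ∀ ξ : Euc n, ξ ≠ 0 → ‖f ξ‖ ≤ C * ‖ξ‖ ^ b.re := by
  have hsub : sphere (0 : Euc n) 1 ⊆ {0}ᶜ := fun x hx h => by simp_all
  obtain ⟨D, hD⟩ := (isCompact_sphere (0 : Euc n) 1).bddAbove_image
    (hf.smooth.continuousOn.mono hsub).norm
  refine ⟨max D 1, by positivity, fun ξ hξ => ?_⟩
  have hn : 0 < ‖ξ‖ := norm_pos_iff.2 hξ
  have hu : ‖ξ‖⁻¹ • ξ ∈ sphere (0 : Euc n) 1 := by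
    simp [norm_smul, hn.ne']
  have e : ξ = ‖ξ‖ • (‖ξ‖⁻¹ • ξ) := by rw [smul_smul, mul_inv_cancel₀ hn.ne', one_smul]
  have h1 := hf.homog ‖ξ‖ hn _ (hsub hu)
  rw [← e] at h1
  rw [h1, norm_mul, Complex.norm_cpow_eq_rpow_re_of_pos hn, mul_comm]
  gcongr
  exact (hD (Set.mem_image_of_mem _ hu)).trans (le_max_left _ _)

lemma Homog.symOn {r : ℝ} (hr : 1 ≤ r) {b : ℂ} {f : Euc n → ℂ} (hf : Homog b f) :
    SymOn r b.re f := by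
  refine ⟨hf.smooth.mono (outerSet_subset_compl hr), fun L => ?_⟩
  obtain ⟨C, hC, h⟩ := (hf.pdIter L).exists_bound
  exact ⟨C, hC, fun ξ hξ => by simpa using h ξ (outerSet_subset_compl hr hξ)⟩

/-! ### Classical expansions outside a ball -/

/-- On the exterior of the ball of radius `r`, the function `f` is a classical symbol of order
`a` with homogeneous components `fc j`. -/
structure Cl (r : ℝ) (a : ℂ) (f : Euc n → ℂ) (fc : ℕ → Euc n → ℂ) : Prop where
  comps : ∀ j : ℕ, Homog (a - j) (fc j)
  est : ∀ N : ℕ, SymOn r (a.re - N) (fun ξ => f ξ - ∑ j ∈ Finset.range N, fc j ξ)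

lemma Cl.contDiffOn {r : ℝ} {a : ℂ} {f : Euc n → ℂ} {fc : ℕ → Euc n → ℂ} (h : Cl r a f fc) :
    ContDiffOn ℝ (⊤ : ℕ∞) f (outerSet n r) := by
  simpa using (h.est 0).1

lemma Cl.congr {r : ℝ} {a : ℂ} {f g : Euc n → ℂ} {fc : ℕ → Euc n → ℂ} (h : Cl r a f fc)
    (e : Set.EqOn g f (outerSet n r)) : Cl r a g fc :=
  ⟨h.comps, fun N => (h.est N).congr fun ξ hξ => by simp only [e hξ]⟩

lemma Cl.mono {r s : ℝ} {a : ℂ} {f : Euc n → ℂ} {fc : ℕ → Euc n → ℂ} (h : Cl r a f fc)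
    (hrs : r ≤ s) : Cl s a f fc :=
  ⟨h.comps, fun N => (h.est N).mono hrs⟩

lemma Cl.const_mul {r : ℝ} {a : ℂ} {f : Euc n → ℂ} {fc : ℕ → Euc n → ℂ} (h : Cl r a f fc)
    (c : ℂ) : Cl r a (fun ξ => c * f ξ) (fun j ξ => c * fc j ξ) :=
  ⟨fun j => (h.comps j).const_mul c, fun N => ((h.est N).const_mul c).congr fun ξ _ => by
    simp only [mul_sub, Finset.mul_sum]⟩

lemma Cl.coord_mul {r : ℝ} (hr : 1 ≤ r) {a : ℂ} {f : Euc n → ℂ} {fc : ℕ → Euc n → ℂ}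
    (h : Cl r a f fc) (i : Fin n) :
    Cl r (a + 1) (fun ξ => coordFn i ξ * f ξ) (fun j ξ => coordFn i ξ * fc j ξ) := by
  refine ⟨fun j => ?_, fun N => ?_⟩
  · have := (homog_coordFn i).mul (h.comps j)
    rwa [show 1 + (a - j) = a + 1 - j by ring] at this
  · have := ((homog_coordFn i).symOn hr).mul hr (h.est N)
    rw [Complex.one_re, show 1 + (a.re - N) = (a + 1).re - N by simp; ring] at this
    exact this.congr fun ξ _ => by simp only [mul_sub, Finset.mul_sum]

lemma Cl.pd {r : ℝ} (hr : 1 ≤ r) {a : ℂ} {f : Euc n → ℂ} {fc : ℕ → Euc n → ℂ}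
    (h : Cl r a f fc) (i : Fin n) : Cl r (a - 1) (pd i f) (fun j => pd i (fc j)) := by
  refine ⟨fun j => ?_, fun N => ?_⟩
  · have := (h.comps j).pd i
    rwa [show a - j - 1 = a - 1 - j by ring] at this
  · have := (h.est N).pd i
    rw [show a.re - N - 1 = (a - 1).re - N by simp; ring] at this
    refine this.congr fun ξ hξ => ?_
    have hd : ∀ j ∈ Finset.range N, DifferentiableAt ℝ (fc j) ξ := fun j _ =>
      (h.comps j).differentiableAt (outerSet_subset_compl hr hξ)
    rw [pd_sub_apply (h.contDiffOn.differentiableAt_of_isOpen (isOpen_outerSet r) hξ)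
      (DifferentiableAt.fun_sum hd), pd_sum_apply _ hd]

lemma Homog.cl {r : ℝ} (hr : 1 ≤ r) {b : ℂ} {f : Euc n → ℂ} (hf : Homog b f) :
    Cl r b f (fun j => if j = 0 then f else fun _ => 0) := by
  refine ⟨fun j => ?_, fun N => ?_⟩
  · by_cases hj : j = 0
    · simpa [hj] using hf
    · simpa [hj] using Homog.zero _
  · rcases N with _ | N
    · simpa using hf.symOn hr
    · refine (SymOn.zero r _).congr fun ξ _ => ?_
      simp [Finset.sum_range_succ']

lemma contDiff_mul_of_zero_near {φ : Euc n → ℝ} (hφ : ContDiffOn ℝ (⊤ : ℕ∞) φ {(0 : Euc n)}ᶜ)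
    (h0 : ∃ ε > (0 : ℝ), ∀ ξ : Euc n, ‖ξ‖ < ε → φ ξ = 0) {f : Euc n → ℂ}
    (hf : ContDiffOn ℝ (⊤ : ℕ∞) f {(0 : Euc n)}ᶜ) :
    ContDiff ℝ (⊤ : ℕ∞) (fun ξ => (φ ξ : ℂ) * f ξ) := by
  rw [contDiff_iff_contDiffAt]
  intro ξ
  by_cases hξ : ξ = 0
  · obtain ⟨ε, hε, h⟩ := h0
    refine contDiffAt_const (c := (0 : ℂ)) |>.congr_of_eventuallyEq ?_
    filter_upwards [ball_mem_nhds ξ hε] with η hη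
    rw [hξ, mem_ball_zero_iff] at hη
    simp [h η hη]
  · have hm := isOpen_compl_singleton.mem_nhds hξ
    exact (Complex.ofRealCLM.contDiff.contDiffAt.comp ξ (hφ.contDiffAt hm)).mul
      (hf.contDiffAt hm)

lemma IsCutoff.mul_smooth {χ : Euc n → ℝ} (hχ : IsCutoff χ) {f : Euc n → ℂ}
    (hf : ContDiffOn ℝ (⊤ : ℕ∞) f {(0 : Euc n)}ᶜ) :
    ContDiff ℝ (⊤ : ℕ∞) (fun ξ => (χ ξ : ℂ) * f ξ) :=
  contDiff_mul_of_zero_near hχ.smooth.contDiffOn hχ.zero_near hf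

lemma IsCutoff.eqOn_mul {χ : Euc n → ℝ} (hχ : IsCutoff χ) (f : Euc n → ℂ) :
    Set.EqOn (fun ξ => (χ ξ : ℂ) * f ξ) f (outerSet n 1) := fun ξ hξ => by
  simp [hχ.one_far ξ (le_of_lt hξ)]

lemma IsCS.cl {χ : Euc n → ℝ} (hχ : IsCutoff χ) {a : ℂ} {σ : Euc n → ℂ} {σc : ℕ → Euc n → ℂ}
    (h : IsCS χ a σ σc) : Cl 1 a σ σc := by
  refine ⟨fun j => ⟨h.comp_smooth j, h.comp_homog j⟩, fun N => ?_⟩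
  have key : SymOn 1 (a.re - N) (fun η => σ η - ∑ j ∈ Finset.range N, (χ η : ℂ) * σc j η) := by
    refine ⟨(h.smooth.sub (ContDiff.sum fun j _ =>
      hχ.mul_smooth (h.comp_smooth j))).contDiffOn, fun L => ?_⟩
    obtain ⟨C, hC, hL⟩ := h.estimate N L
    refine ⟨C * 2 ^ |a.re - N - L.length|, by positivity, fun ξ hξ => (hL ξ).trans ?_⟩
    rw [mul_assoc]
    gcongr
    exact one_add_rpow_le (le_of_lt hξ) _
  exact key.congr fun ξ hξ => by
    simp only
    congr 1
    exact Finset.sum_congr rfl fun j _ => (hχ.eqOn_mul (σc j) hξ).symm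

lemma Cl.isCS {χ : Euc n → ℝ} (hχ : IsCutoff χ) {r : ℝ} (hr : 1 ≤ r) {a : ℂ} {f : Euc n → ℂ}
    {fc : ℕ → Euc n → ℂ} (h : Cl r a f fc) (hf : ContDiff ℝ (⊤ : ℕ∞) f) : IsCS χ a f fc := by
  refine ⟨hf, fun j => (h.comps j).smooth, fun j => (h.comps j).homog, fun N L => ?_⟩
  refine SymOn.exists_bound hr ((h.est N).congr fun ξ hξ => ?_)
    (hf.sub (ContDiff.sum fun j _ => hχ.mul_smooth (h.comps j).smooth)) L
  simp only
  congr 1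
  exact Finset.sum_congr rfl fun j _ => hχ.eqOn_mul (fc j) (outerSet_anti hr hξ)

lemma isSmoothing_of_eqOn_zero {r : ℝ} (hr : 1 ≤ r) {f : Euc n → ℂ}
    (hf : ContDiff ℝ (⊤ : ℕ∞) f) (h : ∀ ξ ∈ outerSet n r, f ξ = 0) : IsSmoothing f := by
  refine ⟨hf, fun L M _ => ?_⟩
  have := ((SymOn.zero r (-M + L.length)).congr h).exists_bound hr hf L
  simpa using this

/-- Extend a function which is smooth outside the unit ball to a smooth function. -/
lemma exists_contDiff_eqOn {f : Euc n → ℂ} (hf : ContDiffOn ℝ (⊤ : ℕ∞) f (outerSet n 1)) :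
    ∃ g : Euc n → ℂ, ContDiff ℝ (⊤ : ℕ∞) g ∧ Set.EqOn g f (outerSet n 2) := by
  let κ : ContDiffBump (0 : Euc n) := ⟨3 / 2, 2, by norm_num, by norm_num⟩
  refine ⟨fun ξ => ((1 - κ ξ : ℝ) : ℂ) * f ξ, ?_, fun ξ hξ => ?_⟩
  · rw [contDiff_iff_contDiffAt]
    intro ξ
    by_cases hξ : ‖ξ‖ < 3 / 2
    · refine contDiffAt_const (c := (0 : ℂ)) |>.congr_of_eventuallyEq ?_
      filter_upwards [isOpen_ball.mem_nhds (mem_ball_zero_iff.2 hξ)] with η hη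
      rw [κ.one_of_mem_closedBall (ball_subset_closedBall hη)]
      simp
    · have h1 : ξ ∈ outerSet n 1 := by
        show 1 < ‖ξ‖
        linarith [not_lt.1 hξ]
      exact (Complex.ofRealCLM.contDiff.contDiffAt.comp ξ
        (contDiffAt_const.sub κ.contDiffAt)).mul
        (hf.contDiffAt ((isOpen_outerSet 1).mem_nhds h1))
  · have : κ ξ = 0 := κ.zero_of_le_dist (by
      simp only [dist_zero_right]
      exact le_of_lt hξ)
    simp [this]

/-- A closed singular linear form vanishes on a symbol which is, outside a ball, the divergence
of a classical vector field. -/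
lemma closed_singular_eq_zero {χ : Euc n → ℝ} (hχ : IsCutoff χ)
    (ρ : CSspan n χ →ₗ[ℂ] ℂ)
    (hsing : ∀ σ : CSspan n χ, IsSmoothing (σ : Euc n → ℂ) → ρ σ = 0)
    (hstokes : ∀ (τ σ : CSspan n χ) (i : Fin n),
      (σ : Euc n → ℂ) = pd i (τ : Euc n → ℂ) → ρ σ = 0)
    {a : ℂ} {f : Fin n → Euc n → ℂ} {fc : Fin n → ℕ → Euc n → ℂ}
    (hf : ∀ i, Cl 1 a (f i) (fc i)) (g : CSspan n χ)
    (hgs : ContDiff ℝ (⊤ : ℕ∞) (g : Euc n → ℂ))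
    (hg : ∀ ξ ∈ outerSet n 1, (g : Euc n → ℂ) ξ = ∑ i, pd i (f i) ξ) : ρ g = 0 := by
  choose τ hτs hτ using fun i => exists_contDiff_eqOn (hf i).contDiffOn
  have hcl : ∀ i, Cl 2 a (τ i) (fc i) := fun i => ((hf i).mono (by norm_num)).congr (hτ i)
  have hmem : ∀ i, τ i ∈ CSspan n χ := fun i =>
    Submodule.subset_span ⟨a, fc i, (hcl i).isCS hχ (by norm_num) (hτs i)⟩
  have hmem' : ∀ i, pd i (τ i) ∈ CSspan n χ := fun i =>
    Submodule.subset_span ⟨a - 1, _,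
      ((hcl i).pd (by norm_num) i).isCS hχ (by norm_num) ((hτs i).pd i)⟩
  let T : Fin n → CSspan n χ := fun i => ⟨pd i (τ i), hmem' i⟩
  have hT : ∀ i, ρ (T i) = 0 := fun i => hstokes ⟨τ i, hmem i⟩ (T i) i rfl
  have hval : ((g - ∑ i, T i : CSspan n χ) : Euc n → ℂ) =
      fun ξ => (g : Euc n → ℂ) ξ - ∑ i, pd i (τ i) ξ := by
    ext ξ
    simp [T, Finset.sum_apply]
  have hd : ρ (g - ∑ i, T i) = 0 := by
    refine hsing _ ?_
    rw [hval]
    refine isSmoothing_of_eqOn_zero (r := 2) (by norm_num)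
      (hgs.sub (ContDiff.sum fun i _ => (hτs i).pd i)) fun ξ hξ => ?_
    rw [hg ξ (outerSet_anti (by norm_num) hξ), sub_eq_zero]
    exact Finset.sum_congr rfl fun i _ => (pd_congr (isOpen_outerSet 2) (hτ i) i hξ).symm
  rw [map_sub, map_sum, Finset.sum_eq_zero fun i _ => hT i, sub_zero] at hd
  exact hd

/-! ### Weighted averages over families of homotheties and translations -/

section Average

variable {P : Type*} [MeasurableSpace P] {μ : Measure P} {a w : P → ℝ} {b : P → Euc n}
  {V W : Set (Euc n)} {f : Euc n → ℂ}

/-- The weighted average of `f` over the affine maps `ξ ↦ a p • ξ + b p`. -/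
def avg (μ : Measure P) (a : P → ℝ) (b : P → Euc n) (w : P → ℝ) (f : Euc n → ℂ) : Euc n → ℂ :=
  fun ξ => ∫ p, w p • f (a p • ξ + b p) ∂μ

/-- Hypotheses under which `avg μ a b w f` may be differentiated under the integral sign
arbitrarily often on `V`. -/
structure Dom (μ : Measure P) (a : P → ℝ) (b : P → Euc n) (V W : Set (Euc n)) (w : P → ℝ)
    (f : Euc n → ℂ) : Prop where
  maps : ∀ᵐ p ∂μ, ∀ ξ ∈ V, a p • ξ + b p ∈ W
  smooth : ContDiffOn ℝ (⊤ : ℕ∞) f W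
  meas : ∀ L : List (Fin n), ∀ ξ ∈ V, AEStronglyMeasurable
    (fun p => (w p * a p ^ L.length) • pdIter L f (a p • ξ + b p)) μ
  dom : ∀ L : List (Fin n), ∀ ξ₀ ∈ V, ∃ s ∈ 𝓝 ξ₀, ∃ bound : P → ℝ, Integrable bound μ ∧
    ∀ᵐ p ∂μ, ∀ ξ ∈ s, ‖(w p * a p ^ L.length) • pdIter L f (a p • ξ + b p)‖ ≤ bound p

lemma Dom.pd (h : Dom μ a b V W w f) (hW : IsOpen W) (i : Fin n) :
    Dom μ a b V W (fun p => w p * a p) (pd i f) := by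
  refine ⟨h.maps, h.smooth.pd hW i, fun L ξ hξ => ?_, fun L ξ hξ => ?_⟩
  · have := h.meas (L ++ [i]) ξ hξ
    simpa [pdIter_concat, pow_succ', mul_assoc] using this
  · have := h.dom (L ++ [i]) ξ hξ
    simpa [pdIter_concat, pow_succ', mul_assoc] using this

lemma Dom.integrable (h : Dom μ a b V W w f) {ξ : Euc n} (hξ : ξ ∈ V) :
    Integrable (fun p => w p • f (a p • ξ + b p)) μ := by
  obtain ⟨s, hs, bd, hbd, hle⟩ := h.dom [] ξ hξ
  have hm := h.meas [] ξ hξ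
  simp only [List.length_nil, pow_zero, mul_one, pdIter] at hm hle
  exact hbd.mono' hm (hle.mono fun p hp => hp ξ (mem_of_mem_nhds hs))

lemma Dom.hasFDerivAt (h : Dom μ a b V W w f) (hV : IsOpen V) (hW : IsOpen W) {ξ : Euc n}
    (hξ : ξ ∈ V) :
    HasFDerivAt (avg μ a b w f) (∑ i, (EuclideanSpace.proj i : Euc n →L[ℝ] ℝ).smulRight
      (avg μ a b (fun p => w p * a p) (_root_.pd i f) ξ)) ξ := by
  choose s hs bd hbd hle using fun i => h.dom [i] ξ hξ
  simp only [List.length_singleton, pow_one, pdIter] at hle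
  let F' : Euc n → P → Euc n →L[ℝ] ℂ := fun η p =>
    ∑ i, (EuclideanSpace.proj i : Euc n →L[ℝ] ℝ).smulRight
      ((w p * a p) • _root_.pd i f (a p • η + b p))
  have hint : ∀ i, Integrable (fun p => (w p * a p) • _root_.pd i f (a p • ξ + b p)) μ :=
    fun i => (h.pd hW i).integrable hξ
  have hint' : ∀ i, Integrable (fun p => (EuclideanSpace.proj i : Euc n →L[ℝ] ℝ).smulRight
      ((w p * a p) • _root_.pd i f (a p • ξ + b p))) μ := fun i =>
    (ContinuousLinearMap.smulRightL ℝ (Euc n) ℂ (EuclideanSpace.proj i)).integrable_comp (hint i)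
  have hF' : AEStronglyMeasurable (F' ξ) μ :=
    Finset.aestronglyMeasurable_fun_sum _ fun i _ => (hint' i).aestronglyMeasurable
  have hbd' : Integrable
      (fun p => ∑ i, ‖(EuclideanSpace.proj i : Euc n →L[ℝ] ℝ)‖ * bd i p) μ :=
    integrable_finsetSum _ fun i _ => (hbd i).const_mul _
  have e : ∑ i, (EuclideanSpace.proj i : Euc n →L[ℝ] ℝ).smulRight
      (avg μ a b (fun p => w p * a p) (_root_.pd i f) ξ) = ∫ p, F' ξ p ∂μ := by
    rw [integral_finsetSum _ fun i _ => hint' i]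
    refine Finset.sum_congr rfl fun i _ => ?_
    exact ((ContinuousLinearMap.smulRightL ℝ (Euc n) ℂ
      (EuclideanSpace.proj i)).integral_comp_comm (hint i)).symm
  rw [e]
  refine hasFDerivAt_integral_of_dominated_of_fderiv_le (F' := F')
    (bound := fun p => ∑ i, ‖(EuclideanSpace.proj i : Euc n →L[ℝ] ℝ)‖ * bd i p)
    (s := V ∩ ⋂ i, s i) (Filter.inter_mem (hV.mem_nhds hξ) (Filter.iInter_mem.2 hs))
    ?_ (h.integrable hξ) hF' ?_ hbd' ?_
  · filter_upwards [hV.mem_nhds hξ] with η hη using (h.integrable hη).1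
  · filter_upwards [ae_all_iff.2 hle] with p hp η hη
    refine (norm_sum_le _ _).trans (Finset.sum_le_sum fun i _ => ?_)
    rw [ContinuousLinearMap.norm_smulRight_apply]
    gcongr
    exact hp i η (Set.mem_iInter.1 hη.2 i)
  · filter_upwards [h.maps] with p hp η hη
    have h1 : HasFDerivAt f (fderiv ℝ f (a p • η + b p)) (a p • η + b p) :=
      (h.smooth.differentiableAt_of_isOpen hW (hp η hη.1)).hasFDerivAt
    have h2 : HasFDerivAt (fun η : Euc n => a p • η + b p)
        (a p • ContinuousLinearMap.id ℝ (Euc n)) η :=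
      ((hasFDerivAt_id η).const_smul (a p)).add_const _
    refine ((h1.comp η h2).const_smul (w p)).congr_fderiv ?_
    rw [fderiv_eq_sum]
    ext v
    simp only [F', FunLike.coe_smul, Pi.smul_apply, ContinuousLinearMap.comp_apply,
      _root_.sum_apply, ContinuousLinearMap.smulRight_apply, Finset.smul_sum,
      ContinuousLinearMap.id_apply, map_smul, smul_smul]
    refine Finset.sum_congr rfl fun i _ => ?_
    simp only [real_smul]
    push_cast
    ring

lemma Dom.pd_avg (h : Dom μ a b V W w f) (hV : IsOpen V) (hW : IsOpen W) (i : Fin n) :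
    Set.EqOn (_root_.pd i (avg μ a b w f)) (avg μ a b (fun p => w p * a p) (_root_.pd i f)) V := by
  intro ξ hξ
  simp [_root_.pd, (h.hasFDerivAt hV hW hξ).fderiv]

lemma Dom.contDiffOn (h : Dom μ a b V W w f) (hV : IsOpen V) (hW : IsOpen W) :
    ContDiffOn ℝ (⊤ : ℕ∞) (avg μ a b w f) V := by
  rw [contDiffOn_infty]
  intro k
  induction k generalizing w f with
  | zero =>
    exact contDiffOn_zero.2 fun ξ hξ => (h.hasFDerivAt hV hW hξ).continuousAt.continuousWithinAt
  | succ k ih =>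
    push_cast
    rw [contDiffOn_succ_iff_fderiv_of_isOpen hV]
    refine ⟨fun ξ hξ => (h.hasFDerivAt hV hW hξ).differentiableAt.differentiableWithinAt,
      by simp, ?_⟩
    refine (ContDiffOn.sum (s := Finset.univ) fun i _ => ?_).congr fun ξ hξ =>
      (h.hasFDerivAt hV hW hξ).fderiv
    exact (ContinuousLinearMap.smulRightL ℝ (Euc n) ℂ
      (EuclideanSpace.proj i)).contDiff.comp_contDiffOn (ih (h.pd hW i))

lemma Dom.pdIter_avg (h : Dom μ a b V W w f) (hV : IsOpen V) (hW : IsOpen W)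
    (L : List (Fin n)) :
    Set.EqOn (pdIter L (avg μ a b w f))
      (avg μ a b (fun p => w p * a p ^ L.length) (pdIter L f)) V := by
  induction L using List.reverseRecOn generalizing w f with
  | nil => intro ξ _; simp [pdIter]
  | append_singleton L i ih =>
    intro ξ hξ
    rw [pdIter_concat, pdIter_congr hV (h.pd_avg hV hW i) L hξ, ih (h.pd hW i) hξ, pdIter_concat]
    simp [pow_succ', mul_assoc]

end Average

/-! ### The radial primitive at infinity -/

/-- The average `∫_1^∞ t ^ k f (t ξ) dt`. -/
def radialAvg (k : ℕ) (f : Euc n → ℂ) : Euc n → ℂ :=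
  avg (volume.restrict (Set.Ioi 1)) (fun t : ℝ => t) (fun _ => 0) (fun t => t ^ k) f

lemma smul_mem_outerSet {t : ℝ} (ht : 1 ≤ t) {ξ : Euc n} (hξ : ξ ∈ outerSet n 1) :
    t • ξ ∈ outerSet n 1 := by
  have h : 1 < ‖ξ‖ := hξ
  show 1 < ‖t • ξ‖
  rw [norm_smul, Real.norm_of_nonneg (by linarith)]
  nlinarith

lemma SymOn.norm_radial_le {m C : ℝ} {f : Euc n → ℂ} {l : ℕ}
    (hC : ∀ ξ ∈ outerSet n 1, ‖f ξ‖ ≤ C * ‖ξ‖ ^ (m - l)) (k : ℕ) {t : ℝ} (ht : 1 ≤ t)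
    {ξ : Euc n} (hξ : ξ ∈ outerSet n 1) :
    ‖(t ^ k * t ^ l) • f (t • ξ)‖ ≤ C * t ^ (m + k) * ‖ξ‖ ^ (m - l) := by
  have ht0 : 0 < t := by linarith
  have h := hC _ (smul_mem_outerSet ht hξ)
  rw [norm_smul, Real.norm_of_nonneg ht0.le, Real.mul_rpow ht0.le (norm_nonneg _)] at h
  rw [norm_smul, Real.norm_of_nonneg (by positivity)]
  calc (t ^ k * t ^ l) * ‖f (t • ξ)‖
      ≤ (t ^ k * t ^ l) * (C * (t ^ (m - l) * ‖ξ‖ ^ (m - l))) := by gcongr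
    _ = C * (t ^ k * t ^ l * t ^ (m - l)) * ‖ξ‖ ^ (m - l) := by ring
    _ = _ := by
      rw [← Real.rpow_natCast, ← Real.rpow_natCast, ← Real.rpow_add ht0, ← Real.rpow_add ht0]
      ring_nf

lemma SymOn.dom_radial {m : ℝ} {f : Euc n → ℂ} (hf : SymOn 1 m f) {k : ℕ} (hk : m + k < -1) :
    Dom (volume.restrict (Set.Ioi 1)) (fun t : ℝ => t) (fun _ => 0) (outerSet n 1)
      (outerSet n 1) (fun t => t ^ k) f := by
  refine ⟨?_, hf.1, fun L ξ hξ => ?_, fun L ξ hξ => ?_⟩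
  · filter_upwards [ae_restrict_mem measurableSet_Ioi] with t ht ξ hξ
    simpa using smul_mem_outerSet (le_of_lt ht) hξ
  · refine ContinuousOn.aestronglyMeasurable ?_ measurableSet_Ioi
    have hw : ContinuousOn (fun t : ℝ => t ^ k * t ^ L.length) (Set.Ioi 1) := by fun_prop
    refine hw.smul ?_
    refine (hf.1.pdIter (isOpen_outerSet 1) L).continuousOn.comp
      (f := fun t : ℝ => t • ξ + 0) (by fun_prop) fun t ht => ?_
    simpa using smul_mem_outerSet (le_of_lt ht) hξ
  · obtain ⟨C, hC, hL⟩ := hf.2 L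
    refine ⟨outerSet n 1, (isOpen_outerSet 1).mem_nhds hξ, fun t => C * t ^ (m + k),
      (integrableOn_Ioi_rpow_of_lt hk one_pos).const_mul C, ?_⟩
    filter_upwards [ae_restrict_mem measurableSet_Ioi] with t ht η hη
    have ht0 : 0 < t := lt_trans one_pos ht
    rw [add_zero]
    refine (SymOn.norm_radial_le hL k (le_of_lt ht) hη).trans ?_
    refine mul_le_of_le_one_right (by positivity) ?_
    refine Real.rpow_le_one_of_one_le_of_nonpos (le_of_lt hη) ?_
    have : (0 : ℝ) ≤ k := k.cast_nonneg
    have : (0 : ℝ) ≤ L.length := L.length.cast_nonneg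
    linarith

lemma SymOn.radialAvg {m : ℝ} {f : Euc n → ℂ} (hf : SymOn 1 m f) {k : ℕ} (hk : m + k < -1) :
    SymOn 1 m (radialAvg k f) := by
  have hd := hf.dom_radial hk
  have hV := isOpen_outerSet (n := n) 1
  refine ⟨hd.contDiffOn hV hV, fun L => ?_⟩
  obtain ⟨C, hC, hL⟩ := hf.2 L
  have hint := integrableOn_Ioi_rpow_of_lt hk one_pos
  have hnn : 0 ≤ ∫ t in Set.Ioi (1 : ℝ), t ^ (m + k) :=
    setIntegral_nonneg measurableSet_Ioi fun t ht =>
      Real.rpow_nonneg (zero_le_one.trans (le_of_lt ht)) _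
  refine ⟨C * ((∫ t in Set.Ioi (1 : ℝ), t ^ (m + k)) + 1), by positivity, fun ξ hξ => ?_⟩
  rw [_root_.radialAvg, hd.pdIter_avg hV hV L hξ]
  have hb : ‖avg (volume.restrict (Set.Ioi 1)) (fun t : ℝ => t) (fun _ => 0)
      (fun t => t ^ k * t ^ L.length) (pdIter L f) ξ‖ ≤
      ∫ t in Set.Ioi (1 : ℝ), C * t ^ (m + k) * ‖ξ‖ ^ (m - L.length) := by
    refine norm_integral_le_of_norm_le ((hint.const_mul C).mul_const _) ?_
    filter_upwards [ae_restrict_mem measurableSet_Ioi] with t ht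
    rw [add_zero]
    exact SymOn.norm_radial_le hL k (le_of_lt ht) hξ
  refine hb.trans ?_
  rw [integral_mul_const, integral_const_mul]
  gcongr
  linarith

lemma radialAvg_sub {m₁ m₂ : ℝ} {f g : Euc n → ℂ} (hf : SymOn 1 m₁ f) (hg : SymOn 1 m₂ g) {k : ℕ}
    (h₁ : m₁ + k < -1) (h₂ : m₂ + k < -1) {ξ : Euc n} (hξ : ξ ∈ outerSet n 1) :
    radialAvg k (fun η => f η - g η) ξ = radialAvg k f ξ - radialAvg k g ξ := by
  simp only [radialAvg, avg]
  rw [← integral_sub ((hf.dom_radial h₁).integrable hξ) ((hg.dom_radial h₂).integrable hξ)]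
  simp only [smul_sub]

lemma radialAvg_sum {ι : Type*} (s : Finset ι) {m : ι → ℝ} {f : ι → Euc n → ℂ}
    (hf : ∀ j ∈ s, SymOn 1 (m j) (f j)) {k : ℕ} (hm : ∀ j ∈ s, m j + k < -1) {ξ : Euc n}
    (hξ : ξ ∈ outerSet n 1) :
    radialAvg k (fun η => ∑ j ∈ s, f j η) ξ = ∑ j ∈ s, radialAvg k (f j) ξ := by
  simp only [radialAvg, avg, Finset.smul_sum]
  exact integral_finsetSum s fun j hj => ((hf j hj).dom_radial (hm j hj)).integrable hξ

lemma Homog.radialAvg {b : ℂ} {f : Euc n → ℂ} (hf : Homog b f) {k : ℕ} (hk : b.re + k < -1)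
    {ξ : Euc n} (hξ : ξ ≠ 0) : radialAvg k f ξ = -((b + k + 1)⁻¹ * f ξ) := by
  simp only [_root_.radialAvg, avg, add_zero]
  have e : ∀ t ∈ Set.Ioi (1 : ℝ), t ^ k • f (t • ξ) = (t : ℂ) ^ (b + k) * f ξ := fun t ht => by
    have ht0 : 0 < t := lt_trans one_pos ht
    rw [hf.homog t ht0 ξ hξ, Complex.cpow_add _ _ (by exact_mod_cast ht0.ne'),
      Complex.cpow_natCast, real_smul]
    push_cast
    ring
  rw [setIntegral_congr_fun measurableSet_Ioi e, integral_mul_const,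
    integral_Ioi_cpow_of_lt (by simpa using hk) one_pos]
  simp
  ring

lemma Cl.radialAvg {a : ℂ} {f : Euc n → ℂ} {fc : ℕ → Euc n → ℂ} (hf : Cl 1 a f fc) {k : ℕ}
    (hk : a.re + k < -1) :
    Cl 1 a (radialAvg k f) (fun j ξ => -(a - j + k + 1)⁻¹ * fc j ξ) := by
  have hlt : ∀ j : ℕ, a.re - j + k < -1 := fun j => by
    have : (0 : ℝ) ≤ j := j.cast_nonneg
    linarith
  have hre : ∀ j : ℕ, (a - j).re + k < -1 := fun j => by simpa using hlt j
  refine ⟨fun j => (hf.comps j).const_mul _, fun N => ?_⟩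
  refine ((hf.est N).radialAvg (hlt N)).congr fun ξ hξ => ?_
  have hsym : ∀ j ∈ Finset.range N, SymOn 1 (a - j).re (fc j) := fun j _ =>
    (hf.comps j).symOn le_rfl
  have h0 : SymOn 1 a.re f := by simpa using hf.est 0
  have hs : SymOn 1 a.re (fun ξ => ∑ j ∈ Finset.range N, fc j ξ) := by
    have := h0.add ((hf.est N).mono_order le_rfl (by simp : a.re - N ≤ a.re) |>.const_mul (-1))
    exact this.congr fun ξ _ => by ring
  rw [radialAvg_sub h0 hs hk hk hξ, radialAvg_sum _ hsym (fun j _ => hre j) hξ]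
  congr 1
  refine Finset.sum_congr rfl fun j _ => ?_
  rw [(hf.comps j).radialAvg (hre j) (outerSet_subset_compl le_rfl hξ)]
  ring

lemma SymOn.tendsto_radial {m : ℝ} {f : Euc n → ℂ} (hf : SymOn 1 m f) {k : ℕ} (hk : m + k < 0)
    {ξ : Euc n} (hξ : ξ ∈ outerSet n 1) :
    Tendsto (fun t : ℝ => t ^ k • f (t • ξ)) atTop (𝓝 0) := by
  obtain ⟨C, hC, hL⟩ := hf.2 []
  have h := ((tendsto_rpow_neg_atTop (neg_pos.2 hk)).const_mul C).mul_const (‖ξ‖ ^ m)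
  rw [neg_neg, mul_zero, zero_mul] at h
  refine squeeze_zero_norm' ?_ h
  filter_upwards [eventually_ge_atTop 1] with t ht
  have := SymOn.norm_radial_le (l := 0) (f := f) (by simpa [pdIter] using hL) k ht hξ
  simpa using this

/-- Symbols of sufficiently negative order are divergences of classical vector fields. -/
lemma Cl.exists_divergence {a : ℂ} {f : Euc n → ℂ} {fc : ℕ → Euc n → ℂ} (hn : 1 ≤ n)
    (hf : Cl 1 a f fc) (ha : a.re < -n) :
    ∃ (g : Fin n → Euc n → ℂ) (gc : Fin n → ℕ → Euc n → ℂ), (∀ i, Cl 1 (a + 1) (g i) (gc i)) ∧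
      ∀ ξ ∈ outerSet n 1, f ξ = ∑ i, _root_.pd i (g i) ξ := by
  obtain ⟨k, rfl⟩ : ∃ k, n = k + 1 := ⟨n - 1, by omega⟩
  have hk : a.re + k < -1 := by push_cast at ha; linarith
  have hV := isOpen_outerSet (n := k + 1) 1
  have h0 : SymOn 1 a.re f := by simpa using hf.est 0
  have hd := h0.dom_radial hk
  have hh := (hf.radialAvg hk).const_mul (-1)
  refine ⟨_, _, fun i => hh.coord_mul le_rfl i, fun ξ hξ => ?_⟩
  have hdiff : DifferentiableAt ℝ (_root_.radialAvg k f) ξ :=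
    (hd.hasFDerivAt hV hV hξ).differentiableAt
  rw [sum_pd_coord_mul (hdiff.const_mul (-1)), fderiv_const_mul hdiff, _root_.radialAvg,
    (hd.hasFDerivAt hV hV hξ).fderiv]
  simp only [FunLike.coe_smul, Pi.smul_apply, _root_.sum_apply,
    ContinuousLinearMap.smulRight_apply, PiLp.proj_apply]
  have hderiv : ∀ t : ℝ, 1 ≤ t → HasDerivAt (fun t : ℝ => t ^ (k + 1) • f (t • ξ))
      (t ^ (k + 1) • fderiv ℝ f (t • ξ) ξ + ((k + 1 : ℕ) * t ^ k : ℝ) • f (t • ξ)) t := by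
    intro t ht
    have h1 := (hf.contDiffOn.differentiableAt_of_isOpen hV
      (smul_mem_outerSet ht hξ)).hasFDerivAt
    have h2 := h1.comp_hasDerivAt t ((hasDerivAt_id t).smul_const ξ)
    rw [one_smul] at h2
    exact (hasDerivAt_pow (k + 1) t).smul h2
  have hi0 : Integrable (fun t : ℝ => ((k + 1 : ℕ) : ℝ) • (t ^ k • f (t • ξ)))
      (volume.restrict (Set.Ioi 1)) := by
    have := hd.integrable hξ
    simp only [add_zero] at this
    exact this.smul ((k + 1 : ℕ) : ℝ)
  have hi1 : ∀ i, Integrable (fun t : ℝ => ξ i • ((t ^ k * t) • _root_.pd i f (t • ξ)))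
      (volume.restrict (Set.Ioi 1)) := fun i => by
    have := (hd.pd hV i).integrable hξ
    simp only [add_zero] at this
    exact this.smul (ξ i)
  have hsplit : ∀ t : ℝ,
      t ^ (k + 1) • fderiv ℝ f (t • ξ) ξ + ((k + 1 : ℕ) * t ^ k : ℝ) • f (t • ξ) =
      (∑ i, ξ i • ((t ^ k * t) • _root_.pd i f (t • ξ))) +
        ((k + 1 : ℕ) : ℝ) • (t ^ k • f (t • ξ)) := fun t => by
    rw [fderiv_apply_eq_sum, Finset.smul_sum, smul_smul]
    congr 1
    refine Finset.sum_congr rfl fun i _ => ?_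
    simp only [real_smul]
    push_cast
    ring
  have hint : IntegrableOn (fun t : ℝ => t ^ (k + 1) • fderiv ℝ f (t • ξ) ξ +
      ((k + 1 : ℕ) * t ^ k : ℝ) • f (t • ξ)) (Set.Ioi 1) := by
    simp only [hsplit]
    exact (integrable_finsetSum _ fun i _ => hi1 i).add hi0
  have hftc := integral_Ioi_of_hasDerivAt_of_tendsto
    (hderiv 1 le_rfl).continuousAt.continuousWithinAt (fun t ht => hderiv t (le_of_lt ht)) hint
    (h0.tendsto_radial (by push_cast at ha ⊢; linarith) hξ)
  simp only [hsplit] at hftc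
  rw [integral_add (integrable_finsetSum _ fun i _ => hi1 i) hi0,
    integral_finsetSum _ fun i _ => hi1 i, integral_smul] at hftc
  simp only [integral_smul] at hftc
  simp only [avg, add_zero]
  simp only [one_pow, one_smul, real_smul, smul_eq_mul] at hftc ⊢
  push_cast at hftc ⊢
  linear_combination hftc

/-! ### Compactly supported vector fields with prescribed divergence -/

lemma HasCompactSupport.pdIter {G : Euc n → ℂ} (hG : HasCompactSupport G) (L : List (Fin n)) :
    HasCompactSupport (pdIter L G) := by
  induction L with
  | nil => exact hG
  | cons i L ih => exact ih.fderiv_apply (𝕜 := ℝ) _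

lemma HasCompactSupport.exists_pdIter_le {G : Euc n → ℂ} (hG : HasCompactSupport G)
    (hs : ContDiff ℝ (⊤ : ℕ∞) G) (L : List (Fin n)) : ∃ C, ∀ ξ, ‖_root_.pdIter L G ξ‖ ≤ C :=
  (hs.pdIter L).continuous.bounded_above_of_compact_support (hG.pdIter L)

lemma HasCompactSupport.exists_radius {E : Type*} [Zero E] {G : Euc n → E}
    (hG : HasCompactSupport G) : ∃ R > 0, ∀ ξ, R < ‖ξ‖ → G ξ = 0 := by
  obtain ⟨R, hR, h⟩ := hG.isCompact.isBounded.exists_pos_norm_le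
  exact ⟨R, hR, fun ξ hξ => image_eq_zero_of_notMem_tsupport fun hm => (h ξ hm).not_gt hξ⟩

/-- The field `∫_0^1 ∫ h_i W(h) G(ξ - s h) dh ds`, whose divergence is the difference of
`(∫ W) G` and the convolution of `W` and `G`. -/
def shiftAvg (i : Fin n) (W : Euc n → ℝ) (G : Euc n → ℂ) : Euc n → ℂ :=
  avg ((volume.restrict (Set.Icc (0 : ℝ) 1)).prod (volume : Measure (Euc n))) (fun _ => 1)
    (fun p => -(p.1 • p.2)) (fun p => p.2 i * W p.2) G

lemma dom_shiftAvg (i : Fin n) {W : Euc n → ℝ} (hW : Continuous W) (hWc : HasCompactSupport W)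
    {G : Euc n → ℂ} (hG : ContDiff ℝ (⊤ : ℕ∞) G) (hGc : HasCompactSupport G) :
    Dom ((volume.restrict (Set.Icc (0 : ℝ) 1)).prod (volume : Measure (Euc n))) (fun _ => 1)
      (fun p => -(p.1 • p.2)) Set.univ Set.univ (fun p => p.2 i * W p.2) G := by
  refine ⟨by simp, hG.contDiffOn, fun L ξ _ => ?_, fun L ξ _ => ?_⟩
  · have := (hG.pdIter L).continuous
    exact Continuous.aestronglyMeasurable (by fun_prop)
  · obtain ⟨C, hC⟩ := hGc.exists_pdIter_le hG L
    have hi : Integrable (fun h : Euc n => h i * W h) :=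
      Continuous.integrable_of_hasCompactSupport (by fun_prop) hWc.mul_left
    refine ⟨Set.univ, univ_mem, fun p => ‖p.2 i * W p.2‖ * C, ?_, ?_⟩
    · exact (hi.comp_snd _).norm.mul_const C
    · refine Eventually.of_forall fun p ξ _ => ?_
      rw [one_pow, mul_one, norm_smul]
      exact mul_le_mul_of_nonneg_left (hC _) (norm_nonneg _)

lemma contDiff_shiftAvg (i : Fin n) {W : Euc n → ℝ} (hW : Continuous W)
    (hWc : HasCompactSupport W) {G : Euc n → ℂ} (hG : ContDiff ℝ (⊤ : ℕ∞) G)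
    (hGc : HasCompactSupport G) : ContDiff ℝ (⊤ : ℕ∞) (shiftAvg i W G) :=
  contDiffOn_univ.1 ((dom_shiftAvg i hW hWc hG hGc).contDiffOn isOpen_univ isOpen_univ)

lemma hasCompactSupport_shiftAvg (i : Fin n) {W : Euc n → ℝ} (hWc : HasCompactSupport W)
    {G : Euc n → ℂ} (hGc : HasCompactSupport G) : HasCompactSupport (shiftAvg i W G) := by
  obtain ⟨R, hR, hRW⟩ := hWc.exists_radius
  obtain ⟨S, hS, hSG⟩ := hGc.exists_radius
  refine HasCompactSupport.intro (isCompact_closedBall 0 (R + S)) fun ξ hξ => ?_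
  rw [mem_closedBall_zero_iff, not_le] at hξ
  refine integral_eq_zero_of_ae ?_
  filter_upwards [Measure.quasiMeasurePreserving_fst.ae
    (ae_restrict_mem (μ := volume) (measurableSet_Icc (a := (0 : ℝ)) (b := 1)))] with p hp
  by_cases hpR : R < ‖p.2‖
  · simp [hRW _ hpR]
  · have : ‖p.1 • p.2‖ ≤ R := by
      rw [norm_smul, Real.norm_of_nonneg hp.1]
      nlinarith [hp.1, hp.2, norm_nonneg p.2]
    rw [hSG]
    · simp
    · rw [one_smul, ← sub_eq_add_neg]
      have := norm_sub_norm_le ξ (p.1 • p.2)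
      linarith

lemma sum_pd_shiftAvg {W : Euc n → ℝ} (hW : Continuous W) (hWc : HasCompactSupport W)
    {G : Euc n → ℂ} (hG : ContDiff ℝ (⊤ : ℕ∞) G) (hGc : HasCompactSupport G) (ξ : Euc n) :
    ∑ i, _root_.pd i (shiftAvg i W G) ξ =
      (∫ h, W h : ℝ) * G ξ - ∫ h, (W h : ℂ) * G (ξ - h) := by
  have hd := fun i => dom_shiftAvg i hW hWc hG hGc
  have hint := fun i => ((hd i).pd isOpen_univ i).integrable (Set.mem_univ ξ)
  have e : ∀ i, _root_.pd i (shiftAvg i W G) ξ = _ := fun i =>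
    (hd i).pd_avg isOpen_univ isOpen_univ i (Set.mem_univ ξ)
  have hGd : Differentiable ℝ G := hG.differentiable (by simp)
  have key : ∀ h : Euc n, ∫ s in Set.Icc (0 : ℝ) 1, fderiv ℝ G (ξ - s • h) h =
      G ξ - G (ξ - h) := fun h => by
    have hder : ∀ s : ℝ, HasDerivAt (fun s : ℝ => -G (ξ - s • h)) (fderiv ℝ G (ξ - s • h) h) s :=
      fun s => by
        have h1 := (hGd (ξ - s • h)).hasFDerivAt.comp_hasDerivAt s
          (((hasDerivAt_id s).smul_const h).const_sub ξ)
        exact h1.neg.congr_deriv (by simp)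
    have hc : Continuous fun s : ℝ => fderiv ℝ G (ξ - s • h) h := by
      have := hG.continuous_fderiv (by simp)
      fun_prop
    rw [integral_Icc_eq_integral_Ioc, ← intervalIntegral.integral_of_le zero_le_one,
      intervalIntegral.integral_eq_sub_of_hasDerivAt (fun s _ => hder s)
        (hc.intervalIntegrable _ _)]
    simp
    ring
  have hsum : ∀ p : ℝ × Euc n, ∑ i, (p.2 i * W p.2 * 1) •
      _root_.pd i G ((1 : ℝ) • ξ + -(p.1 • p.2)) =
      (W p.2 : ℂ) * fderiv ℝ G (ξ - p.1 • p.2) p.2 := fun p => by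
    rw [fderiv_apply_eq_sum, Finset.mul_sum]
    refine Finset.sum_congr rfl fun i _ => ?_
    simp only [real_smul, one_smul, ← sub_eq_add_neg]
    push_cast
    ring
  have hI := integrable_finsetSum Finset.univ fun i _ => hint i
  simp only [e, avg]
  rw [← integral_finsetSum _ fun i _ => hint i]
  simp only [hsum] at hI ⊢
  rw [integral_prod_symm _ hI]
  simp only [integral_const_mul, key, mul_sub]
  have hWC : Continuous fun h => (W h : ℂ) := by fun_prop
  have hWCc : HasCompactSupport fun h => (W h : ℂ) := hWc.comp_left (g := ((↑) : ℝ → ℂ)) rfl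
  have hGcont := hG.continuous
  rw [integral_sub, integral_mul_const, integral_complex_ofReal]
  · exact Continuous.integrable_of_hasCompactSupport (by fun_prop) hWCc.mul_right
  · exact Continuous.integrable_of_hasCompactSupport (by fun_prop) hWCc.mul_right

/-- A compactly supported smooth function of vanishing integral is the divergence of a compactly
supported smooth vector field. -/
lemma exists_compact_divergence {F : Euc n → ℂ} (hF : ContDiff ℝ (⊤ : ℕ∞) F)
    (hFc : HasCompactSupport F) (h0 : ∫ x, F x = 0) :
    ∃ v : Fin n → Euc n → ℂ, (∀ i, ContDiff ℝ (⊤ : ℕ∞) (v i)) ∧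
      (∀ i, HasCompactSupport (v i)) ∧ ∀ ξ, ∑ i, _root_.pd i (v i) ξ = F ξ := by
  let ψ : ContDiffBump (0 : Euc n) := ⟨1, 2, by norm_num, by norm_num⟩
  have hψ : ContDiff ℝ (⊤ : ℕ∞) (ψ : Euc n → ℝ) := ψ.contDiff
  let Ψ : Euc n → ℂ := fun h => (ψ h : ℂ)
  have hΨ : ContDiff ℝ (⊤ : ℕ∞) Ψ := Complex.ofRealCLM.contDiff.comp hψ
  have hΨc : HasCompactSupport Ψ := ψ.hasCompactSupport.comp_left (g := ((↑) : ℝ → ℂ)) rfl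
  have hFcont := hF.continuous
  have hΨcont := hΨ.continuous
  have hre : Continuous fun h => (F h).re := by fun_prop
  have him : Continuous fun h => (F h).im := by fun_prop
  have hrec : HasCompactSupport fun h => (F h).re := hFc.comp_left (g := re) rfl
  have himc : HasCompactSupport fun h => (F h).im := hFc.comp_left (g := im) rfl
  have hm : ((∫ h, ψ h : ℝ) : ℂ) ≠ 0 := by exact_mod_cast (ψ.integral_pos (μ := volume)).ne'
  set m : ℂ := ((∫ h, ψ h : ℝ) : ℂ)
  have s1 := fun i => contDiff_shiftAvg i hψ.continuous ψ.hasCompactSupport hF hFc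
  have s2 := fun i => contDiff_shiftAvg i hre hrec hΨ hΨc
  have s3 := fun i => contDiff_shiftAvg i him himc hΨ hΨc
  have d1 := sum_pd_shiftAvg hψ.continuous ψ.hasCompactSupport hF hFc
  have d2 := sum_pd_shiftAvg hre hrec hΨ hΨc
  have d3 := sum_pd_shiftAvg him himc hΨ hΨc
  refine ⟨fun i ξ => m⁻¹ * (shiftAvg i ψ F ξ - (shiftAvg i (fun h => (F h).re) Ψ ξ +
    I * shiftAvg i (fun h => (F h).im) Ψ ξ)), fun i => ?_, fun i => ?_, fun ξ => ?_⟩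
  · exact contDiff_const.mul ((s1 i).sub ((s2 i).add (contDiff_const.mul (s3 i))))
  · exact ((hasCompactSupport_shiftAvg i ψ.hasCompactSupport hFc).sub
      ((hasCompactSupport_shiftAvg i hrec hΨc).add
        (hasCompactSupport_shiftAvg i himc hΨc).mul_left)).mul_left
  · have t1 := fun i => (s1 i).differentiable (by simp) ξ
    have t2 := fun i => (s2 i).differentiable (by simp) ξ
    have t3 := fun i => (s3 i).differentiable (by simp) ξ
    have e : ∀ i, _root_.pd i (fun ξ => m⁻¹ * (shiftAvg i ψ F ξ -
        (shiftAvg i (fun h => (F h).re) Ψ ξ + I * shiftAvg i (fun h => (F h).im) Ψ ξ))) ξ =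
        m⁻¹ * (_root_.pd i (shiftAvg i ψ F) ξ - (_root_.pd i (shiftAvg i (fun h => (F h).re) Ψ) ξ
          + I * _root_.pd i (shiftAvg i (fun h => (F h).im) Ψ) ξ)) := fun i => by
      rw [pd_const_mul_apply ((t1 i).fun_sub ((t2 i).fun_add ((t3 i).const_mul _))),
        pd_sub_apply (t1 i) ((t2 i).fun_add ((t3 i).const_mul _)),
        pd_add_apply (t2 i) ((t3 i).const_mul _), pd_const_mul_apply (t3 i)]
    simp only [e]
    rw [← Finset.mul_sum, Finset.sum_sub_distrib, Finset.sum_add_distrib, ← Finset.mul_sum,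
      d1, d2, d3]
    have hFi : Integrable F := hFcont.integrable_of_hasCompactSupport hFc
    have c1 : ((∫ h, (F h).re : ℝ) : ℂ) + I * ((∫ h, (F h).im : ℝ) : ℂ) = 0 := by
      have := integral_re_add_im hFi
      rw [h0] at this
      simp only [RCLike.re_to_complex, RCLike.im_to_complex] at this
      rw [mul_comm]
      exact this
    have c2 : (∫ h, ((F h).re : ℂ) * Ψ (ξ - h)) + I * ∫ h, ((F h).im : ℂ) * Ψ (ξ - h) =
        ∫ h, Ψ h * F (ξ - h) := by
      rw [← integral_const_mul, ← integral_add]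
      · rw [← integral_sub_left_eq_self (fun h => Ψ h * F (ξ - h)) volume ξ]
        refine integral_congr_ae (Eventually.of_forall fun h => ?_)
        have := re_add_im (F h)
        simp only [sub_sub_cancel]
        linear_combination Ψ (ξ - h) * this
      · refine Continuous.integrable_of_hasCompactSupport (by fun_prop) ?_
        exact (hFc.comp_left (g := fun z : ℂ => (z.re : ℂ)) (by simp)).mul_right
      · refine (Continuous.integrable_of_hasCompactSupport (by fun_prop) ?_).const_mul _
        exact (hFc.comp_left (g := fun z : ℂ => (z.im : ℂ)) (by simp)).mul_right
    have hmm : m⁻¹ * m = 1 := inv_mul_cancel₀ hm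
    linear_combination (-m⁻¹ * Ψ ξ) * c1 + m⁻¹ * c2 + F ξ * hmm

/-! ### Homogeneous functions as divergences -/

lemma dom_Ioi {G : Euc n → ℂ} (hG : ContDiff ℝ (⊤ : ℕ∞) G) (hGc : HasCompactSupport G) (k : ℕ) :
    Dom (volume.restrict (Set.Ioi 0)) (fun t : ℝ => t) (fun _ => 0) {(0 : Euc n)}ᶜ
      Set.univ (fun t => t ^ k) G := by
  refine ⟨by simp, hG.contDiffOn, fun L ξ _ => ?_, fun L ξ hξ => ?_⟩
  · have := (hG.pdIter L).continuous
    exact Continuous.aestronglyMeasurable (by fun_prop)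
  · obtain ⟨C, hC⟩ := hGc.exists_pdIter_le hG L
    obtain ⟨R, hR, hRG⟩ := (hGc.pdIter L).exists_radius
    have hξ0 : 0 < ‖ξ‖ := norm_pos_iff.2 hξ
    refine ⟨ball ξ (‖ξ‖ / 2), ball_mem_nhds _ (by positivity),
      (Set.Ioc 0 (2 * R / ‖ξ‖)).indicator fun t => t ^ k * t ^ L.length * C, ?_, ?_⟩
    · refine (IntegrableOn.integrable_indicator ?_ measurableSet_Ioc).restrict
      exact (Continuous.integrableOn_Icc (by fun_prop)).mono_set Set.Ioc_subset_Icc_self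
    · filter_upwards [ae_restrict_mem measurableSet_Ioi] with t ht η hη
      have ht0 : 0 < t := ht
      rw [add_zero]
      by_cases htR : t ≤ 2 * R / ‖ξ‖
      · rw [Set.indicator_of_mem (show t ∈ Set.Ioc 0 _ from ⟨ht, htR⟩), norm_smul,
          Real.norm_of_nonneg (by positivity)]
        exact mul_le_mul_of_nonneg_left (hC _) (by positivity)
      · rw [hRG, smul_zero, norm_zero]
        · exact Set.indicator_nonneg (fun s hs => by
            have := hs.1
            have := (norm_nonneg _).trans (hC 0)
            positivity) t
        · rw [not_le, div_lt_iff₀ hξ0] at htR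
          rw [mem_ball, dist_comm, dist_eq_norm] at hη
          have := norm_sub_norm_le ξ η
          rw [norm_smul, Real.norm_of_nonneg ht0.le]
          nlinarith

lemma homog_avg_Ioi {G : Euc n → ℂ} (hG : ContDiff ℝ (⊤ : ℕ∞) G) (hGc : HasCompactSupport G)
    (k : ℕ) : Homog (-(k + 1 : ℂ))
      (avg (volume.restrict (Set.Ioi 0)) (fun t : ℝ => t) (fun _ => 0) (fun t => t ^ k) G) := by
  refine ⟨(dom_Ioi hG hGc k).contDiffOn isOpen_compl_singleton isOpen_univ, fun c hc ξ _ => ?_⟩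
  have h := integral_comp_mul_right_Ioi (fun t : ℝ => t ^ k • G (t • ξ)) 0 hc
  rw [zero_mul] at h
  have e : ∀ t : ℝ, (t * c) ^ k • G ((t * c) • ξ) = (c : ℂ) ^ k * t ^ k • G (t • c • ξ) :=
    fun t => by
      rw [smul_smul]
      simp only [real_smul]
      push_cast
      ring
  simp only [e] at h
  rw [integral_const_mul, real_smul] at h
  have hc0 : (c : ℂ) ≠ 0 := by exact_mod_cast hc.ne'
  simp only [avg, add_zero]
  rw [Complex.cpow_neg, Complex.cpow_add _ _ hc0, Complex.cpow_natCast, Complex.cpow_one]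
  push_cast at h
  field_simp at h ⊢
  linear_combination h

lemma integral_eq_integral_sphere_Ioi (hn : 1 ≤ n) {F : Euc n → ℂ} {f : Euc n → ℂ} {u : ℝ → ℝ}
    (h : ∀ ω : Euc n, ‖ω‖ = 1 → ∀ r : ℝ, 0 < r → F (r • ω) = u r * f ω) :
    ∫ x, F x = sphInt f *
      ∫ r : Set.Ioi (0 : ℝ), (u r : ℂ) ∂(Measure.volumeIoiPow (Module.finrank ℝ (Euc n) - 1)) := by
  have : Nontrivial (Euc n) := by
    have : Nonempty (Fin n) := ⟨⟨0, hn⟩⟩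
    infer_instance
  calc
    ∫ x, F x = ∫ x : ({(0 : Euc n)}ᶜ : Set (Euc n)), F x
        ∂((volume : Measure (Euc n)).comap (↑)) := by
      rw [integral_subtype_comap (measurableSet_singleton _).compl F, restrict_compl_singleton]
    _ = ∫ p : sphere (0 : Euc n) 1 × Set.Ioi (0 : ℝ), f p.1 * (u p.2 : ℂ)
        ∂(volume : Measure (Euc n)).toSphere.prod
          (.volumeIoiPow (Module.finrank ℝ (Euc n) - 1)) := by
      rw [← (volume : Measure (Euc n)).measurePreserving_homeomorphUnitSphereProd.integral_comp
        (Homeomorph.measurableEmbedding _) fun p => f p.1 * (u p.2 : ℂ)]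
      refine integral_congr_ae (Eventually.of_forall fun x => ?_)
      have hx : 0 < ‖(x : Euc n)‖ := norm_pos_iff.2 x.2
      have hω := h (‖(x : Euc n)‖⁻¹ • (x : Euc n)) (by
        rw [norm_smul, norm_inv, norm_norm, inv_mul_cancel₀ hx.ne']) _ hx
      rw [smul_smul, mul_inv_cancel₀ hx.ne', one_smul] at hω
      simp [hω, mul_comm]
    _ = _ := by
      rw [integral_prod_mul (fun ω : sphere (0 : Euc n) 1 => f ω)
        (fun r : Set.Ioi (0 : ℝ) => (u r : ℂ))]
      rfl

/-- A homogeneous function of degree `-n` of vanishing spherical mean is the divergence of a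
homogeneous vector field. -/
lemma Homog.exists_divergence_of_sphInt_eq_zero (hn : 2 ≤ n) {f : Euc n → ℂ}
    (hf : Homog (-(n : ℂ)) f) (h0 : sphInt f = 0) :
    ∃ g : Fin n → Euc n → ℂ, (∀ i, Homog (-(n : ℂ) + 1) (g i)) ∧
      ∀ ξ, ξ ≠ 0 → ∑ i, _root_.pd i (g i) ξ = f ξ := by
  obtain ⟨k, rfl⟩ : ∃ k, n = k + 2 := ⟨n - 2, by omega⟩
  let β : ContDiffBump (2 : ℝ) := ⟨1 / 2, 1, by norm_num, by norm_num⟩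
  have hβ : ContDiff ℝ (⊤ : ℕ∞) (β : ℝ → ℝ) := β.contDiff
  have hβ0 : ∀ t : ℝ, t ≤ 1 → β t = 0 := fun t ht => β.zero_of_le_dist (by
    rw [Real.dist_eq, abs_sub_comm, abs_of_nonneg (by linarith)]
    show (1 : ℝ) ≤ _
    linarith)
  have hβ3 : ∀ t : ℝ, 3 ≤ t → β t = 0 := fun t ht => β.zero_of_le_dist (by
    rw [Real.dist_eq, abs_of_nonneg (by linarith)]
    show (1 : ℝ) ≤ _
    linarith)
  let F : Euc (k + 2) → ℂ := fun x => ((‖x‖ * β ‖x‖ : ℝ) : ℂ) * f x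
  have hnorm : ContDiffOn ℝ (⊤ : ℕ∞) (fun x : Euc (k + 2) => ‖x‖) {(0 : Euc (k + 2))}ᶜ :=
    fun x hx => (contDiffAt_norm ℝ hx).contDiffWithinAt
  have hF : ContDiff ℝ (⊤ : ℕ∞) F :=
    contDiff_mul_of_zero_near (hnorm.mul (hβ.comp_contDiffOn hnorm))
      ⟨1, one_pos, fun ξ hξ => by simp [hβ0 _ hξ.le]⟩ hf.smooth
  have hFc : HasCompactSupport F := by
    refine HasCompactSupport.intro (isCompact_closedBall 0 3) fun ξ hξ => ?_
    rw [mem_closedBall_zero_iff, not_le] at hξ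
    simp [F, hβ3 _ hξ.le]
  have hFhom : ∀ ξ : Euc (k + 2), ξ ≠ 0 → ∀ t : ℝ, 0 < t →
      (t : ℂ) ^ (k + 1) * F (t • ξ) = ((‖ξ‖ * β (t * ‖ξ‖) : ℝ) : ℂ) * f ξ := fun ξ hξ t ht => by
    have ht0 : (t : ℂ) ≠ 0 := by exact_mod_cast ht.ne'
    simp only [F]
    rw [hf.homog t ht ξ hξ, norm_smul, Real.norm_of_nonneg ht.le, Complex.cpow_neg,
      Complex.cpow_natCast]
    push_cast
    field_simp
    ring
  have hint : ∫ x, F x = 0 := by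
    rw [integral_eq_integral_sphere_Ioi (u := fun r => β r / r ^ (k + 1)) (f := f) (by omega)
      fun ω hω r hr => ?_, h0, zero_mul]
    have hr0 : (r : ℂ) ≠ 0 := by exact_mod_cast hr.ne'
    have := hFhom ω (norm_ne_zero_iff.1 (by simp [hω])) r hr
    rw [hω, one_mul, mul_one] at this
    push_cast
    field_simp
    linear_combination this
  obtain ⟨v, hv, hvc, hdiv⟩ := exists_compact_divergence hF hFc hint
  have hd := fun i => dom_Ioi (hv i) (hvc i) k
  have hm : ((∫ t, β t : ℝ) : ℂ) ≠ 0 := by exact_mod_cast (β.integral_pos (μ := volume)).ne'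
  set m : ℂ := ((∫ t, β t : ℝ) : ℂ) with hmdef
  refine ⟨fun i ξ => m⁻¹ * avg (volume.restrict (Set.Ioi 0)) (fun t : ℝ => t) (fun _ => 0)
    (fun t => t ^ k) (v i) ξ, fun i => ?_, fun ξ hξ => ?_⟩
  · have := (homog_avg_Ioi (hv i) (hvc i) k).const_mul m⁻¹
    convert this using 1
    push_cast
    ring
  · have hV : IsOpen ({(0 : Euc (k + 2))}ᶜ) := isOpen_compl_singleton
    have e : ∀ i, _root_.pd i (fun ξ => m⁻¹ * avg (volume.restrict (Set.Ioi 0)) (fun t : ℝ => t)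
        (fun _ => 0) (fun t => t ^ k) (v i) ξ) ξ = m⁻¹ * ∫ t in Set.Ioi (0 : ℝ),
          (t ^ k * t) • _root_.pd i (v i) (t • ξ + 0) := fun i => by
      rw [pd_const_mul_apply ((hd i).hasFDerivAt hV isOpen_univ hξ).differentiableAt,
        (hd i).pd_avg hV isOpen_univ i hξ]
      rfl
    simp only [e]
    rw [← Finset.mul_sum, ← integral_finsetSum _ fun i _ =>
      ((hd i).pd isOpen_univ i).integrable hξ]
    simp only [← Finset.smul_sum, hdiv, add_zero]
    have e2 : ∀ t ∈ Set.Ioi (0 : ℝ), (t ^ k * t) • F (t • ξ) =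
        (‖ξ‖ : ℂ) * f ξ * (β (t * ‖ξ‖) : ℂ) := fun t ht => by
      have := hFhom ξ hξ t ht
      rw [real_smul]
      push_cast at this ⊢
      linear_combination this
    have hξ0 : 0 < ‖ξ‖ := norm_pos_iff.2 hξ
    have hξ1 : (‖ξ‖ : ℂ) ≠ 0 := by exact_mod_cast hξ0.ne'
    have e3 : ∫ t in Set.Ioi (0 : ℝ), (β t : ℂ) = m := by
      rw [setIntegral_eq_integral_of_forall_compl_eq_zero fun t ht => ?_, integral_complex_ofReal]
      rw [Set.mem_Ioi, not_lt] at ht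
      simp [hβ0 t (by linarith)]
    rw [setIntegral_congr_fun measurableSet_Ioi e2, integral_const_mul,
      integral_comp_mul_right_Ioi (fun t => (β t : ℂ)) 0 hξ0, zero_mul, e3, real_smul]
    push_cast
    field_simp

/-- A homogeneous function of degree different from `-n` is a divergence, by Euler's identity. -/
lemma Homog.exists_divergence {b : ℂ} (hb : b ≠ -(n : ℂ)) {f : Euc n → ℂ} (hf : Homog b f) :
    ∃ g : Fin n → Euc n → ℂ, (∀ i, Homog (b + 1) (g i)) ∧
      ∀ ξ, ξ ≠ 0 → ∑ i, _root_.pd i (g i) ξ = f ξ := by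
  have hb' : b + n ≠ 0 := fun h => hb (eq_neg_of_add_eq_zero_left h)
  refine ⟨fun i ξ => coordFn i ξ * ((b + n)⁻¹ * f ξ), fun i => ?_, fun ξ hξ => ?_⟩
  · rw [add_comm]
    exact (homog_coordFn i).mul (hf.const_mul _)
  · rw [sum_pd_coord_mul ((hf.const_mul _).differentiableAt hξ), (hf.const_mul _).fderiv_self hξ]
    field_simp
    ring

end Auxiliary

/-- A singular linear form with Stokes' property vanishes on the kernel of the
noncommutative residue. -/
theorem ker_res_subset_ker {n : ℕ} (hn : 2 ≤ n) {χ : Euc n → ℝ} (hχ : IsCutoff χ)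
    (ρ : CSspan n χ →ₗ[ℂ] ℂ)
    (hsing : ∀ σ : CSspan n χ, IsSmoothing (σ : Euc n → ℂ) → ρ σ = 0)
    (hstokes : ∀ (τ σ : CSspan n χ) (i : Fin n),
      (σ : Euc n → ℂ) = pd i (τ : Euc n → ℂ) → ρ σ = 0)
    (σ : CSspan n χ) (a : ℂ) (σc : ℕ → Euc n → ℂ)
    (hσ : IsCS χ a (σ : Euc n → ℂ) σc) (hres : resCC a σc = 0) :
    ρ σ = 0 := by
  obtain ⟨N, hN⟩ : ∃ N : ℕ, a.re - N < -n := by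
    obtain ⟨N, hN⟩ := exists_nat_gt (a.re + n)
    exact ⟨N, by linarith⟩
  have hcl := hσ.cl hχ
  have hsph : ∀ j : ℕ, a - j = -(n : ℂ) → sphInt (σc j) = 0 := fun j hj => by
    have hex : ∃ j : ℕ, a - j = -(n : ℂ) := ⟨j, hj⟩
    have hch : hex.choose = j := by
      have := hex.choose_spec.trans hj.symm
      exact_mod_cast sub_right_injective this
    rw [resCC, dif_pos hex, hch, mul_eq_zero] at hres
    refine hres.resolve_left ?_
    exact_mod_cast (Real.rpow_pos_of_pos Real.two_pi_pos _).ne'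
  have hdiv : ∀ j : ℕ, ∃ g : Fin n → Euc n → ℂ, (∀ i, Homog (a - j + 1) (g i)) ∧
      ∀ ξ, ξ ≠ 0 → ∑ i, pd i (g i) ξ = σc j ξ := fun j => by
    by_cases hj : a - j = -(n : ℂ)
    · rw [hj]
      exact Homog.exists_divergence_of_sphInt_eq_zero hn (hj ▸ hcl.comps j) (hsph j hj)
    · exact (hcl.comps j).exists_divergence hj
  have hcut : ∀ j : ℕ, ContDiff ℝ (⊤ : ℕ∞) (fun ξ => (χ ξ : ℂ) * σc j ξ) := fun j =>
    hχ.mul_smooth (hcl.comps j).smooth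
  have hmem : ∀ j : ℕ, (fun ξ => (χ ξ : ℂ) * σc j ξ) ∈ CSspan n χ := fun j =>
    Submodule.subset_span ⟨_, _, (((hcl.comps j).cl le_rfl).congr (hχ.eqOn_mul (σc j))).isCS hχ
      le_rfl (hcut j)⟩
  let S : ℕ → CSspan n χ := fun j => ⟨_, hmem j⟩
  have hS : ∀ j, ρ (S j) = 0 := fun j => by
    obtain ⟨g, hg, hgd⟩ := hdiv j
    refine closed_singular_eq_zero hχ ρ hsing hstokes (fun i => (hg i).cl le_rfl) (S j) (hcut j)
      fun ξ hξ => ?_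
    rw [hgd ξ (outerSet_subset_compl le_rfl hξ)]
    exact hχ.eqOn_mul (σc j) hξ
  have hval : ((σ - ∑ j ∈ Finset.range N, S j : CSspan n χ) : Euc n → ℂ) =
      fun ξ => (σ : Euc n → ℂ) ξ - ∑ j ∈ Finset.range N, (χ ξ : ℂ) * σc j ξ := by
    ext ξ
    simp [S, Finset.sum_apply]
  have hR : Cl 1 (a - N) ((σ - ∑ j ∈ Finset.range N, S j : CSspan n χ) : Euc n → ℂ)
      (fun j => σc (N + j)) := by
    refine ⟨fun j => ?_, fun M => ?_⟩
    · have := hcl.comps (N + j)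
      rwa [show a - (N + j : ℕ) = a - N - j by push_cast; ring] at this
    · have := hcl.est (N + M)
      rw [show a.re - (N + M : ℕ) = (a - N).re - M by simp; ring] at this
      refine this.congr fun ξ hξ => ?_
      simp only [hval, Finset.sum_range_add, hχ.one_far ξ (le_of_lt hξ), ofReal_one, one_mul]
      ring
  obtain ⟨g, gc, hg, hgd⟩ := hR.exists_divergence (by omega) (by simpa using hN)
  have h0 := closed_singular_eq_zero hχ ρ hsing hstokes hg _ (by
    rw [hval]
    exact hσ.smooth.sub (ContDiff.sum fun j _ => hcut j)) hgd
  rwa [map_sub, map_sum, Finset.sum_eq_zero fun j _ => hS j, sub_zero] at h0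

end
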